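/- arXiv:1912.09298 — 4 statements merged into one kernel-verified Lean document; each statement's English description precedes it below -/
import Mathlib

section
/- Let d ≥ 1, let Φ be a finite set of atomic τ₀-constraints over variables v₁,…,v_d, and let α₁,…,α_d, u be rational numbers. Set K' := K(Φ) ∪ {1, ε, ε^{−1}}, C' := { |k|·∏_{r=1}^s |h_r|^{e_r} : k ∈ K', e₁,…,e_s ∈ ℤ, Σ_r |e_r| < d } (h₁,…,h_s an enumeration of H(Φ)), C^⋆ := { x + n·x·ε³ : x ∈ C', n ∈ ℤ, −d ≤ n ≤ d }, and D := (−C^⋆) ∪ {0} ∪ C^⋆ ⊆ ℚ((ε)). Then the following are equivalent: (1) Φ has a simultaneous solution (x₁,…,x_d) ∈ ℚ^d with Σ_{i=1}^d α_i x_i ≤ u; (2) Φ, interpreted in ℚ((ε)), has a simultaneous solution (x'₁,…,x'_d) ∈ D^d with Σ_{i=1}^d α_i x'_i ≤ u. -/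
open scoped Classical

/-- `ℚ((ε))`: the field of formal Laurent series over `ℚ`. -/
abbrev Qstar : Type := LaurentSeries ℚ

/-- The leading coefficient of a Laurent series (its coefficient at the least
exponent with nonzero coefficient; `0` for the zero series). -/
noncomputable def lead (a : Qstar) : ℚ := a.coeff a.order

/-- The order on `ℚ((ε))`: `a < b` iff `b - a` is positive, i.e. iff the
leading coefficient of `b - a` is positive. -/
def QstarLt (a b : Qstar) : Prop := 0 < lead (b - a)

/-- The corresponding non-strict order on `ℚ((ε))`. -/
def QstarLe (a b : Qstar) : Prop := QstarLt a b ∨ a = b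

/-- Absolute value on `ℚ((ε))` with respect to this order. -/
noncomputable def qabs (a : Qstar) : Qstar := if QstarLt a 0 then -a else a

/-- The natural embedding of `ℚ` into `ℚ((ε))`. -/
noncomputable def qc (c : ℚ) : Qstar := HahnSeries.C c

/-- The indeterminate `ε`. -/
noncomputable def eps : Qstar := HahnSeries.single (1 : ℤ) (1 : ℚ)

/-- `ℚ^⋆_{m,n}`: the Laurent series all of whose nonzero coefficients lie in
exponents between `m` and `n`. -/
def QstarBand (m n : ℤ) : Set Qstar := { x | ∀ i : ℤ, x.coeff i ≠ 0 → m ≤ i ∧ i ≤ n }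

/-- An atomic `τ₀`-constraint over variables `v₁,…,v_d`: one of the forms
`c₁·v_i σ c₂·v_j`, `c·v_i σ k`, or `k σ c·v_i`, where `σ ∈ {<,=}` is encoded by
the Boolean `strict` (`true` for `<`, `false` for `=`). -/
inductive Atom (d : ℕ) : Type
  | vv (c₁ c₂ : ℚ) (i j : Fin d) (strict : Bool)
  | vk (c k : ℚ) (i : Fin d) (strict : Bool)
  | kv (k c : ℚ) (i : Fin d) (strict : Bool)
  deriving DecidableEq

/-- Well-formedness: the coefficients are nonzero and, in two-variable
constraints, not both negative. -/
def Atom.WellFormed {d : ℕ} : Atom d → Prop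
  | .vv c₁ c₂ _ _ _ => c₁ ≠ 0 ∧ c₂ ≠ 0 ∧ ¬(c₁ < 0 ∧ c₂ < 0)
  | .vk c _ _ _ => c ≠ 0
  | .kv _ c _ _ => c ≠ 0

/-- Satisfaction of an atomic constraint in `ℚ` under the assignment `x`,
where the strict symbol `<` is interpreted by the relation `lt` (take
`(· < ·)` for the constraint itself, and `(· ≤ ·)` for its closure). -/
def Atom.Holds {d : ℕ} (lt : ℚ → ℚ → Prop) (x : Fin d → ℚ) : Atom d → Prop
  | .vv c₁ c₂ i j s => if s then lt (c₁ * x i) (c₂ * x j) else c₁ * x i = c₂ * x j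
  | .vk c k i s => if s then lt (c * x i) k else c * x i = k
  | .kv k c i s => if s then lt k (c * x i) else k = c * x i

/-- `H(Φ) := {c₁/c₂ : some constraint c₁·v_i σ c₂·v_j is in Φ}`. -/
def Hset {d : ℕ} (Φ : Finset (Atom d)) : Set ℚ :=
  { h | ∃ c₁ c₂ i j s, Atom.vv c₁ c₂ i j s ∈ Φ ∧ h = c₁ / c₂ }

/-- `K(Φ) := {k/c : some constraint c·v_i σ k or k σ c·v_i is in Φ}`. -/
def Kset {d : ℕ} (Φ : Finset (Atom d)) : Set ℚ :=
  { q | ∃ c k i s, (Atom.vk c k i s ∈ Φ ∨ Atom.kv k c i s ∈ Φ) ∧ q = k / c }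

/-- `C_{Φ,d} := { |k|·∏_{r=1}^s |h_r|^{e_r} : k ∈ K(Φ) ∪ {1}, e ∈ ℤ^s,
Σ_r |e_r| < d }`, where `h₁,…,h_s` is an enumeration of `H(Φ)`. -/
def Cset {d : ℕ} (Φ : Finset (Atom d)) : Set ℚ :=
  { x | ∃ k : ℚ, (k ∈ Kset Φ ∨ k = 1) ∧
      ∃ (s : ℕ) (h : Fin s → ℚ) (e : Fin s → ℤ),
        Function.Injective h ∧ (∀ q, q ∈ Hset Φ ↔ ∃ r, h r = q) ∧
        (∑ r, (e r).natAbs) < d ∧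
        x = |k| * ∏ r, |h r| ^ (e r) }

/-- Satisfaction of an atomic `τ₀`-constraint in `ℚ((ε))` under the assignment
`x`, reading rational constants and coefficients via the natural embedding of
`ℚ` into `ℚ((ε))`; the strict symbol `<` is interpreted by the relation `lt`
(take `QstarLt` for the constraint itself). -/
def Atom.HoldsStar {d : ℕ} (lt : Qstar → Qstar → Prop) (x : Fin d → Qstar) :
    Atom d → Prop
  | .vv c₁ c₂ i j s =>
      if s then lt (qc c₁ * x i) (qc c₂ * x j) else qc c₁ * x i = qc c₂ * x j
  | .vk c k i s => if s then lt (qc c * x i) (qc k) else qc c * x i = qc k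
  | .kv k c i s => if s then lt (qc k) (qc c * x i) else qc k = qc c * x i

/-- `K' := K(Φ) ∪ {1, ε, ε⁻¹} ⊆ ℚ((ε))`. -/
def Kset' {d : ℕ} (Φ : Finset (Atom d)) : Set Qstar :=
  { q | (∃ k ∈ Kset Φ, q = qc k) ∨ q = 1 ∨ q = eps ∨ q = eps⁻¹ }

/-- `C' := { |k|·∏_{r=1}^s |h_r|^{e_r} : k ∈ K', e ∈ ℤ^s, Σ_r |e_r| < d }`,
where `h₁,…,h_s` is an enumeration of `H(Φ)`. -/
def Cset' {d : ℕ} (Φ : Finset (Atom d)) : Set Qstar :=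
  { x | ∃ k ∈ Kset' Φ,
      ∃ (s : ℕ) (h : Fin s → ℚ) (e : Fin s → ℤ),
        Function.Injective h ∧ (∀ q, q ∈ Hset Φ ↔ ∃ r, h r = q) ∧
        (∑ r, (e r).natAbs) < d ∧
        x = qabs k * qc (∏ r, |h r| ^ (e r)) }

/-- `C^⋆ := { x + n·x·ε³ : x ∈ C', n ∈ ℤ, −d ≤ n ≤ d }`. -/
def CstarSet' {d : ℕ} (Φ : Finset (Atom d)) : Set Qstar :=
  { y | ∃ x ∈ Cset' Φ, ∃ n : ℤ, -(d : ℤ) ≤ n ∧ n ≤ d ∧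
      y = x + qc (n : ℚ) * x * eps ^ 3 }

/-- `D := (−C^⋆) ∪ {0} ∪ C^⋆ ⊆ ℚ((ε))`. -/
def Dset' {d : ℕ} (Φ : Finset (Atom d)) : Set Qstar :=
  { y | (∃ z ∈ CstarSet' Φ, y = -z) ∨ y = 0 ∨ y ∈ CstarSet' Φ }


noncomputable instance qlo : LinearOrder Qstar :=
  inferInstanceAs (LinearOrder (Lex (HahnSeries ℤ ℚ)))

instance qsor : IsStrictOrderedRing Qstar :=
  inferInstanceAs (IsStrictOrderedRing (Lex (HahnSeries ℤ ℚ)))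

lemma qlt_iff (a b : Qstar) : QstarLt a b ↔ a < b := by
  unfold QstarLt lead
  rw [← HahnSeries.leadingCoeff_eq, ← sub_pos (a := b)]
  exact HahnSeries.leadingCoeff_pos_iff (x := toLex (b - a))

lemma qle_iff (a b : Qstar) : QstarLe a b ↔ a ≤ b := by
  unfold QstarLe; rw [qlt_iff, le_iff_lt_or_eq]

lemma qpos_iff (a : Qstar) : 0 < a ↔ ∃ m, 0 < a.coeff m ∧ ∀ i < m, a.coeff i = 0 := by
  have h : 0 < a ↔ 0 < a.leadingCoeff :=
    (HahnSeries.leadingCoeff_pos_iff (x := toLex a)).symm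
  rw [h, HahnSeries.leadingCoeff_eq]
  constructor
  · intro h
    exact ⟨a.order, h, fun i hi => HahnSeries.coeff_eq_zero_of_lt_order hi⟩
  · rintro ⟨m, hm, h⟩
    have : a.order = m := by
      apply le_antisymm
      · exact HahnSeries.order_le_of_coeff_ne_zero hm.ne'
      · by_contra hc
        push Not at hc
        have := h _ hc
        rw [HahnSeries.coeff_order_eq_zero] at this
        simp [this] at hm
    rwa [this]

lemma qc_eq_single (c : ℚ) : qc c = HahnSeries.single (0 : ℤ) c := rfl

lemma coeff_qc_mul (c : ℚ) (y : Qstar) (m : ℤ) : (qc c * y).coeff m = c * y.coeff m := by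
  unfold qc; rw [HahnSeries.C_mul_eq_smul]; rfl

lemma qc_add (a b : ℚ) : qc (a + b) = qc a + qc b := map_add HahnSeries.C a b
lemma qc_sub (a b : ℚ) : qc (a - b) = qc a - qc b := map_sub HahnSeries.C a b
lemma qc_neg (a : ℚ) : qc (-a) = -qc a := map_neg HahnSeries.C a
lemma qc_mul (a b : ℚ) : qc (a * b) = qc a * qc b := map_mul HahnSeries.C a b
lemma qc_zero : qc 0 = 0 := map_zero HahnSeries.C
lemma qc_one : qc 1 = 1 := map_one HahnSeries.C
lemma qc_inv (a : ℚ) : qc (a⁻¹) = (qc a)⁻¹ := map_inv₀ (HahnSeries.C (Γ := ℤ) (R := ℚ)) a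
lemma qc_sum {ι : Type*} (s : Finset ι) (f : ι → ℚ) : qc (∑ i ∈ s, f i) = ∑ i ∈ s, qc (f i) :=
  map_sum HahnSeries.C f s

lemma single_qpos {e : ℤ} {q : ℚ} (hq : 0 < q) : (0 : Qstar) < HahnSeries.single e q := by
  rw [qpos_iff]
  refine ⟨e, by simpa using hq, fun i hi => ?_⟩
  rw [HahnSeries.coeff_single_of_ne hi.ne]

lemma qc_pos {q : ℚ} (hq : 0 < q) : 0 < qc q := single_qpos hq

lemma qc_lt {a b : ℚ} (h : a < b) : qc a < qc b := by
  have := qc_pos (sub_pos.2 h)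
  rwa [qc_sub, sub_pos] at this

lemma qc_strictMono : StrictMono qc := fun _ _ h => qc_lt h

lemma qc_lt_iff {a b : ℚ} : qc a < qc b ↔ a < b :=
  qc_strictMono.lt_iff_lt

lemma qc_le_iff {a b : ℚ} : qc a ≤ qc b ↔ a ≤ b :=
  qc_strictMono.le_iff_le

lemma qc_inj {a b : ℚ} : qc a = qc b ↔ a = b :=
  qc_strictMono.injective.eq_iff

lemma eps_pos : 0 < eps := single_qpos one_pos

lemma eps_lt {q : ℚ} (hq : 0 < q) : eps < qc q := by
  rw [← sub_pos, qpos_iff]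
  refine ⟨0, ?_, fun i hi => ?_⟩
  · simpa [eps, qc_eq_single, HahnSeries.coeff_single] using hq
  · simp only [eps, qc_eq_single, HahnSeries.coeff_sub]
    rw [HahnSeries.coeff_single_of_ne (by omega), HahnSeries.coeff_single_of_ne (by omega)]; simp

lemma qabs_eq (a : Qstar) : qabs a = |a| := by
  unfold qabs
  split_ifs with h
  · rw [qlt_iff] at h; rw [abs_of_neg h]
  · rw [qlt_iff] at h; rw [abs_of_nonneg (not_lt.1 h)]

lemma qc_abs (a : ℚ) : |qc a| = qc |a| := by
  rcases le_total 0 a with h | h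
  · rw [abs_of_nonneg h, abs_of_nonneg (by rw [← qc_zero]; exact qc_le_iff.2 h)]
  · rw [abs_of_nonpos h, abs_of_nonpos (by rw [← qc_zero]; exact qc_le_iff.2 h), qc_neg]

/-- A positive series supported in exponents at most 1 dominates terms of order at least 2. -/
lemma pos_add_small {y z : Qstar} (hy : 0 < y) (hb : y ∈ QstarBand (-1) 1)
    (hz : ∀ i < 2, z.coeff i = 0) : 0 < y + z := by
  rw [qpos_iff] at hy ⊢
  obtain ⟨m, hm, h⟩ := hy
  have := hb m hm.ne'
  refine ⟨m, ?_, fun i hi => ?_⟩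
  · rw [HahnSeries.coeff_add, hz m (by omega)]; simpa using hm
  · rw [HahnSeries.coeff_add, hz i (by omega), h i hi]; simp

lemma band_sub {m n : ℤ} {x y : Qstar} (hx : x ∈ QstarBand m n) (hy : y ∈ QstarBand m n) :
    x - y ∈ QstarBand m n := by
  intro i hi
  by_cases h : x.coeff i = 0
  · by_cases h' : y.coeff i = 0
    · simp [h, h'] at hi
    · exact hy i h'
  · exact hx i h

lemma band_qc_mul {m n : ℤ} {x : Qstar} (c : ℚ) (hx : x ∈ QstarBand m n) :
    qc c * x ∈ QstarBand m n := by
  intro i hi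
  rw [coeff_qc_mul] at hi
  exact hx i (right_ne_zero_of_mul hi)

lemma band_sum {m n : ℤ} {ι : Type*} (s : Finset ι) (f : ι → Qstar)
    (h : ∀ i ∈ s, f i ∈ QstarBand m n) : ∑ i ∈ s, f i ∈ QstarBand m n := by
  intro i hi
  rw [HahnSeries.coeff_sum] at hi
  obtain ⟨j, hj, h'⟩ := Finset.exists_ne_zero_of_sum_ne_zero hi
  exact h j hj i h'

lemma band_single {m n e : ℤ} (q : ℚ) (h1 : m ≤ e) (h2 : e ≤ n) :
    (HahnSeries.single e q : Qstar) ∈ QstarBand m n := by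
  intro i hi
  have := HahnSeries.eq_of_mem_support_single hi
  omega

lemma band_qc (q : ℚ) : qc q ∈ QstarBand (-1) 1 := band_single q (by norm_num) (by norm_num)

lemma coeff_mul_eps3 (x : Qstar) (i : ℤ) : (x * eps ^ 3).coeff i = x.coeff (i - 3) := by
  unfold eps
  rw [HahnSeries.single_pow, HahnSeries.coeff_mul_single]; simp

lemma pert_small {x : Qstar} (n : ℚ) (hb : x ∈ QstarBand (-1) 1) :
    ∀ i < 2, (qc n * x * eps ^ 3).coeff i = 0 := by
  intro i hi
  rw [coeff_mul_eps3, coeff_qc_mul]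
  by_contra h
  have := hb _ (right_ne_zero_of_mul h)
  omega

/-- The graph of tight constraints. -/
def tightG {V F : Type*} [Mul F] (E : Finset (V × V × F)) (v : V → F) : SimpleGraph V :=
  SimpleGraph.fromRel (fun i j => ∃ a, (i, j, a) ∈ E ∧ a * v i = v j)

lemma scale_exists {V F : Type*} [Fintype V] [Field F] [LinearOrder F] [IsStrictOrderedRing F]
    (E : Finset (V × V × F)) (hpos : ∀ i j a, (i, j, a) ∈ E → 0 < a) (T : Set V)
    (w : V → F) (hw : ∀ i, 0 < w i)
    (hf : ∀ i j a, (i, j, a) ∈ E → a * w i ≤ w j)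
    (hout : ∃ i j a, (i, j, a) ∈ E ∧ i ∈ T ∧ j ∉ T)
    (hin : ∃ i j a, (i, j, a) ∈ E ∧ i ∉ T ∧ j ∈ T) (S : F) :
    ∃ t : F, 0 < t ∧ t * S ≤ S ∧
      (∀ i j a, (i, j, a) ∈ E → i ∈ T → j ∉ T → a * (t * w i) ≤ w j) ∧
      (∀ i j a, (i, j, a) ∈ E → i ∉ T → j ∈ T → a * w i ≤ t * w j) ∧
      ((∃ i j a, (i, j, a) ∈ E ∧ i ∈ T ∧ j ∉ T ∧ a * (t * w i) = w j) ∨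
       (∃ i j a, (i, j, a) ∈ E ∧ i ∉ T ∧ j ∈ T ∧ a * w i = t * w j)) := by
  rcases lt_or_ge S 0 with hS | hS
  · obtain ⟨i0, j0, a0, h0⟩ := hout
    obtain ⟨⟨i, j, a⟩, he, hmin⟩ := Finset.exists_min_image
      (E.filter (fun e => e.1 ∈ T ∧ e.2.1 ∉ T)) (fun e => w e.2.1 / (e.2.2 * w e.1))
      ⟨(i0, j0, a0), by simpa using h0⟩
    simp only [Finset.mem_filter] at he hmin
    have ha := hpos _ _ _ he.1
    have haw : 0 < a * w i := mul_pos ha (hw i)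
    have h1 : 1 ≤ w j / (a * w i) := by
      rw [le_div_iff₀ haw, one_mul]; exact hf _ _ _ he.1
    refine ⟨w j / (a * w i), by linarith, by nlinarith, ?_, ?_, Or.inl ⟨i, j, a, he.1, he.2.1, he.2.2, ?_⟩⟩
    · intro i' j' a' he' hi hj
      have hm := hmin (i', j', a') ⟨he', hi, hj⟩
      simp only at hm
      have haw' : 0 < a' * w i' := mul_pos (hpos _ _ _ he') (hw i')
      rw [le_div_iff₀ haw'] at hm
      linarith
    · intro i' j' a' he' hi hj
      have := hf _ _ _ he'
      nlinarith [hw j']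
    · have := hw i
      field_simp
  · obtain ⟨i0, j0, a0, h0⟩ := hin
    obtain ⟨⟨i, j, a⟩, he, hmin⟩ := Finset.exists_max_image
      (E.filter (fun e => e.1 ∉ T ∧ e.2.1 ∈ T)) (fun e => (e.2.2 * w e.1) / w e.2.1)
      ⟨(i0, j0, a0), by simpa using h0⟩
    simp only [Finset.mem_filter] at he hmin
    have ha := hpos _ _ _ he.1
    have haw : 0 < a * w i := mul_pos ha (hw i)
    have h1 : a * w i / w j ≤ 1 := by
      rw [div_le_iff₀ (hw j), one_mul]; exact hf _ _ _ he.1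
    refine ⟨a * w i / w j, div_pos haw (hw j), by nlinarith, ?_, ?_, Or.inr ⟨i, j, a, he.1, he.2.1, he.2.2, ?_⟩⟩
    · intro i' j' a' he' hi hj
      have := hf _ _ _ he'
      have haw' : 0 < a' * w i' := mul_pos (hpos _ _ _ he') (hw i')
      nlinarith
    · intro i' j' a' he' hi hj
      have hm := hmin (i', j', a') ⟨he', hi, hj⟩
      simp only at hm
      rwa [div_le_iff₀ (hw j')] at hm
    · have := hw j
      field_simp

lemma vertex_exists {V F : Type*} [Fintype V] [Field F] [LinearOrder F] [IsStrictOrderedRing F]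
    (E : Finset (V × V × F)) (hpos : ∀ i j a, (i, j, a) ∈ E → 0 < a) (r : V) (c : V → F)
    (hup : ∀ i, i ≠ r → ∃ a, (i, r, a) ∈ E) (hlo : ∀ i, i ≠ r → ∃ a, (r, i, a) ∈ E) (N : ℕ) :
    ∀ w : V → F, (E.filter (fun e => ¬ e.2.2 * w e.1 = w e.2.1)).card ≤ N →
    (∀ i, 0 < w i) → w r = 1 → (∀ i j a, (i, j, a) ∈ E → a * w i ≤ w j) →
    ∃ v : V → F, (∀ i, 0 < v i) ∧ v r = 1 ∧ (∀ i j a, (i, j, a) ∈ E → a * v i ≤ v j) ∧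
      ∑ i, c i * v i ≤ ∑ i, c i * w i ∧ ∀ i, (tightG E v).Reachable i r := by
  induction N using Nat.strong_induction_on with
  | _ N ih =>
  intro w hN hw hr hf
  by_cases hT : ∀ i, (tightG E w).Reachable i r
  · exact ⟨w, hw, hr, hf, le_rfl, hT⟩
  push Not at hT
  obtain ⟨i0, hi0⟩ := hT
  let T : Set V := {i | ¬ (tightG E w).Reachable i r}
  have hrT : r ∉ T := fun h => h (SimpleGraph.Reachable.refl r)
  have hi0T : i0 ∈ T := hi0
  have hne : i0 ≠ r := fun h => hrT (h ▸ hi0T)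
  -- tight edges do not cross
  have hcross : ∀ i j a, (i, j, a) ∈ E → a * w i = w j → (i ∈ T ↔ j ∈ T) := by
    intro i j a he ht
    by_cases hij : i = j
    · rw [hij]
    have hadj : (tightG E w).Adj i j := by
      unfold tightG
      rw [SimpleGraph.fromRel_adj]
      exact ⟨hij, Or.inl ⟨a, he, ht⟩⟩
    show ¬ _ ↔ ¬ _
    rw [not_iff_not]
    exact ⟨fun h => hadj.reachable.symm.trans h, fun h => hadj.reachable.trans h⟩
  obtain ⟨au, hau⟩ := hup i0 hne
  obtain ⟨al, hal⟩ := hlo i0 hne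
  obtain ⟨t, ht, hS, h1, h2, h3⟩ := scale_exists E hpos T w hw hf
    ⟨i0, r, au, hau, hi0T, hrT⟩ ⟨r, i0, al, hal, hrT, hi0T⟩
    (∑ i, if i ∈ T then c i * w i else 0)
  let v : V → F := fun i => if i ∈ T then t * w i else w i
  have hvT : ∀ i, i ∈ T → v i = t * w i := fun i hi => if_pos hi
  have hvT' : ∀ i, i ∉ T → v i = w i := fun i hi => if_neg hi
  have hv : ∀ i, 0 < v i := by
    intro i
    by_cases hi : i ∈ T
    · rw [hvT i hi]; exact mul_pos ht (hw i)
    · rw [hvT' i hi]; exact hw i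
  have hvf : ∀ i j a, (i, j, a) ∈ E → a * v i ≤ v j := by
    intro i j a he
    by_cases hi : i ∈ T <;> by_cases hj : j ∈ T
    · rw [hvT i hi, hvT j hj]
      have := mul_le_mul_of_nonneg_left (hf i j a he) ht.le
      linarith
    · rw [hvT i hi, hvT' j hj]; exact h1 i j a he hi hj
    · rw [hvT' i hi, hvT j hj]; exact h2 i j a he hi hj
    · rw [hvT' i hi, hvT' j hj]; exact hf i j a he
  have hvt : ∀ i j a, (i, j, a) ∈ E → a * w i = w j → a * v i = v j := by
    intro i j a he hh
    have hc := hcross i j a he hh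
    by_cases hi : i ∈ T
    · rw [hvT i hi, hvT j (hc.1 hi), ← hh]; ring
    · rw [hvT' i hi, hvT' j (fun h => hi (hc.2 h))]; exact hh
  have hobj : ∑ i, c i * v i ≤ ∑ i, c i * w i := by
    have e1 : ∑ i, c i * v i - ∑ i, c i * w i
        = t * (∑ i, if i ∈ T then c i * w i else 0) - ∑ i, if i ∈ T then c i * w i else 0 := by
      rw [Finset.mul_sum, ← Finset.sum_sub_distrib, ← Finset.sum_sub_distrib]
      refine Finset.sum_congr rfl fun i _ => ?_
      by_cases hi : i ∈ T
      · rw [hvT i hi, if_pos hi]; ring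
      · rw [hvT' i hi, if_neg hi]; ring
    linarith
  have hcard : (E.filter (fun e => ¬ e.2.2 * v e.1 = v e.2.1)).card <
      (E.filter (fun e => ¬ e.2.2 * w e.1 = w e.2.1)).card := by
    apply Finset.card_lt_card
    rw [Finset.ssubset_iff_of_subset]
    · rcases h3 with ⟨i, j, a, he, hi, hj, hh⟩ | ⟨i, j, a, he, hi, hj, hh⟩
      · refine ⟨(i, j, a), ?_, ?_⟩
        · simp only [Finset.mem_filter]
          exact ⟨he, fun h => hj ((hcross i j a he h).1 hi)⟩
        · simp only [Finset.mem_filter, not_and, not_not]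
          intro _
          rw [hvT i hi, hvT' j hj, hh]
      · refine ⟨(i, j, a), ?_, ?_⟩
        · simp only [Finset.mem_filter]
          exact ⟨he, fun h => hi ((hcross i j a he h).2 hj)⟩
        · simp only [Finset.mem_filter, not_and, not_not]
          intro _
          rw [hvT' i hi, hvT j hj, hh]
    · intro ⟨i, j, a⟩ he
      simp only [Finset.mem_filter] at he ⊢
      exact ⟨he.1, fun h => he.2 (hvt i j a he.1 h)⟩
  obtain ⟨v', g1, g2, g3, g4, g5⟩ := ih _ (hcard.trans_le hN) v le_rfl hv
    ((hvT' r hrT).trans hr) hvf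
  exact ⟨v', g1, g2, g3, g4.trans hobj, g5⟩

lemma rank_exists {V F : Type*} [Fintype V] [LinearOrder F] (z : V → F) (r : V) (d : ℕ)
    (hd : Fintype.card V ≤ d + 1) :
    ∃ n : V → ℤ, n r = 0 ∧ (∀ i, -(d : ℤ) ≤ n i ∧ n i ≤ d) ∧
      (∀ i j, z i < z j → n i < n j) ∧ (∀ i j, z i = z j → n i = n j) := by
  let g : F → ℕ := fun x => ((Finset.univ.image z).filter (· < x)).card
  have hg : ∀ i, g (z i) ≤ d := by
    intro i
    have : g (z i) < (Finset.univ.image z).card := by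
      apply Finset.card_lt_card
      rw [Finset.ssubset_iff_of_subset (Finset.filter_subset _ _)]
      exact ⟨z i, by simp, by simp⟩
    have h2 : (Finset.univ.image z).card ≤ Fintype.card V := Finset.card_image_le
    omega
  refine ⟨fun i => (g (z i) : ℤ) - g (z r), by simp, fun i => ?_, fun i j h => ?_, fun i j h => ?_⟩
  · have := hg i
    have := hg r
    constructor <;> dsimp only <;> omega
  · have : g (z i) < g (z j) := by
      apply Finset.card_lt_card
      rw [Finset.ssubset_iff_of_subset]
      · exact ⟨z i, by simpa using h, by simp⟩
      · intro x hx
        simp only [Finset.mem_filter] at hx ⊢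
        exact ⟨hx.1, hx.2.trans h⟩
    simp only; omega
  · simp only [h]

lemma eventually_poly_pos (N : ℕ) : ∀ (a : ℕ → ℚ) (m : ℕ), m < N → 0 < a m → (∀ i < m, a i = 0) →
    ∀ᶠ t in nhdsWithin (0 : ℚ) (Set.Ioi 0), 0 < ∑ k ∈ Finset.range N, a k * t ^ k := by
  induction N with
  | zero => intro a m hm; omega
  | succ N ih =>
    intro a m hm ha hz
    rcases Nat.eq_zero_or_pos m with h0 | h0
    · subst h0
      have hc : Continuous (fun t : ℚ => ∑ k ∈ Finset.range (N + 1), a k * t ^ k) := by fun_prop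
      have h1 := hc.tendsto 0
      have h2 : ∑ k ∈ Finset.range (N + 1), a k * (0 : ℚ) ^ k = a 0 := by
        rw [Finset.sum_range_succ']; simp
      simp only [h2] at h1
      exact (h1.eventually (lt_mem_nhds ha)).filter_mono nhdsWithin_le_nhds
    · have := ih (fun k => a (k + 1)) (m - 1) (by omega) (by simpa [Nat.sub_add_cancel h0] using ha)
        (fun i hi => hz _ (by omega))
      filter_upwards [this, self_mem_nhdsWithin] with t ht ht0
      rw [Finset.sum_range_succ', hz 0 h0]
      have e : ∑ k ∈ Finset.range N, a (k + 1) * t ^ (k + 1)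
          = t * ∑ k ∈ Finset.range N, a (k + 1) * t ^ k := by
        rw [Finset.mul_sum]; refine Finset.sum_congr rfl fun k _ => ?_; ring
      rw [e]
      have : (0:ℚ) < t := ht0
      simp only [zero_mul, add_zero]
      exact mul_pos this ht

lemma move_cases {V : Type*} [Fintype V] (r : V) (w : V → ℚ) (hw : ∀ i, 0 < w i) (hr : w r = 1)
    (R : Finset (V × V × ℚ)) (c : V → ℚ) (u : ℚ) (hu : ∑ i, c i * w i ≤ u) :
    (∀ δ : V → ℚ, δ r = 0 → (∀ i j a, (i, j, a) ∈ R → a * w i = w j → a * δ i = δ j) →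
      ∑ i, c i * δ i = 0) ∨
    (∃ w' : V → ℚ, (∀ i, 0 < w' i) ∧ w' r = 1 ∧
      (∀ i j a, (i, j, a) ∈ R → a * w i < w j → a * w' i < w' j) ∧
      (∀ i j a, (i, j, a) ∈ R → a * w i = w j → a * w' i = w' j) ∧
      ∑ i, c i * w' i < u) := by
  by_cases h : (∀ δ : V → ℚ, δ r = 0 → (∀ i j a, (i, j, a) ∈ R → a * w i = w j → a * δ i = δ j) →
      ∑ i, c i * δ i = 0)
  · exact Or.inl h
  right
  push Not at h
  obtain ⟨δ', hδr', hδ', hc'⟩ := h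
  obtain ⟨δ, hδr, hδ, hc⟩ : ∃ δ : V → ℚ, δ r = 0 ∧
      (∀ i j a, (i, j, a) ∈ R → a * w i = w j → a * δ i = δ j) ∧ ∑ i, c i * δ i < 0 := by
    rcases lt_or_gt_of_ne hc' with h | h
    · exact ⟨δ', hδr', hδ', h⟩
    · refine ⟨fun i => -δ' i, by simp [hδr'], fun i j a he h => ?_, ?_⟩
      · have := hδ' i j a he h
        linarith
      · simpa using h
  have ev1 : ∀ᶠ t in nhdsWithin (0 : ℚ) (Set.Ioi 0), ∀ i, 0 < w i + t * δ i := by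
    rw [Filter.eventually_all]
    intro i
    have hcont : Continuous (fun t : ℚ => w i + t * δ i) := by fun_prop
    have h1 := hcont.tendsto 0
    simp only [zero_mul, add_zero] at h1
    exact (h1.eventually (lt_mem_nhds (hw i))).filter_mono nhdsWithin_le_nhds
  have ev2 : ∀ᶠ t in nhdsWithin (0 : ℚ) (Set.Ioi 0), ∀ e ∈ R, e.2.2 * w e.1 < w e.2.1 →
      0 < (w e.2.1 + t * δ e.2.1) - e.2.2 * (w e.1 + t * δ e.1) := by
    rw [Filter.eventually_all_finset]
    intro e he
    by_cases hlt : e.2.2 * w e.1 < w e.2.1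
    · have hcont : Continuous (fun t : ℚ => (w e.2.1 + t * δ e.2.1) - e.2.2 * (w e.1 + t * δ e.1)) := by
        fun_prop
      have h1 := hcont.tendsto 0
      simp only [zero_mul, add_zero] at h1
      filter_upwards [(h1.eventually (lt_mem_nhds (sub_pos.2 hlt))).filter_mono
        nhdsWithin_le_nhds] with t ht _ using ht
    · exact Filter.Eventually.of_forall fun t h => absurd h hlt
  obtain ⟨t, ht1, ht2, ht0⟩ := (ev1.and (ev2.and self_mem_nhdsWithin)).exists
  have ht0 : (0:ℚ) < t := ht0
  refine ⟨fun i => w i + t * δ i, ht1, by simp [hr, hδr], fun i j a he hlt => ?_,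
    fun i j a he heq => ?_, ?_⟩
  · have := ht2 (i, j, a) he hlt
    simp only at this ⊢
    linarith
  · have := hδ i j a he heq
    simp only
    rw [← this, ← heq]; ring
  · have e : ∑ i, c i * (w i + t * δ i) = ∑ i, c i * w i + t * ∑ i, c i * δ i := by
      rw [Finset.mul_sum, ← Finset.sum_add_distrib]
      refine Finset.sum_congr rfl fun i _ => ?_; ring
    rw [e]
    nlinarith

/-- The constraint set over `ℚ((ε))`. -/
noncomputable def EE {V : Type*} [Fintype V] (r : V) (w : V → ℚ) (R : Finset (V × V × ℚ)) :
    Finset (V × V × Qstar) :=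
  (R.filter (fun e => e.2.2 * w e.1 ≤ w e.2.1)).image (fun e => (e.1, e.2.1, qc e.2.2)) ∪
  ((Finset.univ : Finset (V × V)).filter (fun e => e.1 ≠ e.2 ∧ (e.1 = r ∨ e.2 = r))).image
    (fun e => (e.1, e.2, eps))

lemma mem_EE {V : Type*} [Fintype V] (r : V) (w : V → ℚ) (R : Finset (V × V × ℚ))
    (i j : V) (b : Qstar) : (i, j, b) ∈ EE r w R ↔
      (∃ a, (i, j, a) ∈ R ∧ a * w i ≤ w j ∧ b = qc a) ∨ (b = eps ∧ i ≠ j ∧ (i = r ∨ j = r)) := by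
  unfold EE
  simp only [Finset.mem_union, Finset.mem_image, Finset.mem_filter, Prod.mk.injEq, Prod.exists,
    Finset.mem_univ, true_and]
  constructor
  · rintro (⟨i', j', a, ⟨h1, h2⟩, rfl, rfl, rfl⟩ | ⟨i', j', ⟨h1, h2⟩, rfl, rfl, rfl⟩)
    · exact Or.inl ⟨a, h1, h2, rfl⟩
    · exact Or.inr ⟨rfl, h1, h2⟩
  · rintro (⟨a, h1, h2, rfl⟩ | ⟨rfl, h1, h2⟩)
    · exact Or.inl ⟨i, j, a, ⟨h1, h2⟩, rfl, rfl, rfl⟩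
    · exact Or.inr ⟨i, j, ⟨h1, h2⟩, rfl, rfl, rfl⟩

lemma qstar_vertex {V : Type*} [Fintype V] (r : V) (w : V → ℚ) (hw : ∀ i, 0 < w i) (hr : w r = 1)
    (R : Finset (V × V × ℚ)) (hR : ∀ i j a, (i, j, a) ∈ R → 0 < a) (c : V → ℚ) :
    ∃ v : V → Qstar, (∀ i, 0 < v i) ∧ v r = 1 ∧
      (∀ i j a, (i, j, a) ∈ R → a * w i ≤ w j → qc a * v i ≤ v j) ∧
      ∑ i, qc (c i) * v i ≤ qc (∑ i, c i * w i) ∧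
      ∀ i, (tightG (EE r w R) v).Reachable i r := by
  obtain ⟨v, h1, h2, h3, h4, h5⟩ := vertex_exists (EE r w R) (by
      intro i j b h
      rw [mem_EE] at h
      rcases h with ⟨a, ha, _, rfl⟩ | ⟨rfl, _⟩
      · exact qc_pos (hR i j a ha)
      · exact eps_pos) r (fun i => qc (c i))
    (fun i hi => ⟨eps, by rw [mem_EE]; exact Or.inr ⟨rfl, hi, Or.inr rfl⟩⟩)
    (fun i hi => ⟨eps, by rw [mem_EE]; exact Or.inr ⟨rfl, hi.symm, Or.inl rfl⟩⟩)
    _ (fun i => qc (w i)) le_rfl (fun i => qc_pos (hw i)) (by simp [hr, qc_one]) (by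
      intro i j b h
      rw [mem_EE] at h
      rcases h with ⟨a, ha, h, rfl⟩ | ⟨rfl, _⟩
      · rw [← qc_mul]; exact qc_le_iff.2 h
      · have h1 := eps_lt (div_pos (hw j) (hw i))
        have h2 : qc (w j) = qc (w j / w i) * qc (w i) := by
          rw [← qc_mul, div_mul_cancel₀ _ (hw i).ne']
        rw [h2]
        exact mul_le_mul_of_nonneg_right h1.le (qc_pos (hw i)).le)
  refine ⟨v, h1, h2, fun i j a ha h => h3 i j _ (by rw [mem_EE]; exact Or.inl ⟨a, ha, h, rfl⟩), ?_, h5⟩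
  rw [qc_sum]
  simpa only [qc_mul] using h4

lemma perturb {V : Type*} [Fintype V] (r : V) (w : V → ℚ)
    (R : Finset (V × V × ℚ)) (hR : ∀ i j a, (i, j, a) ∈ R → 0 < a)
    (hinv : ∀ i j a, (i, j, a) ∈ R → (j, i, a⁻¹) ∈ R)
    (v : V → Qstar) (hv : ∀ i, 0 < v i) (hb : ∀ i, v i ∈ QstarBand (-1) 1)
    (hvR : ∀ i j a, (i, j, a) ∈ R → a * w i ≤ w j → qc a * v i ≤ v j)
    (d : ℕ) (hd : Fintype.card V ≤ d + 1) :
    ∃ n : V → ℤ, n r = 0 ∧ (∀ i, -(d : ℤ) ≤ n i ∧ n i ≤ d) ∧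
      (∀ i, 0 < v i + qc (n i) * v i * eps ^ 3) ∧
      (∀ i j a, (i, j, a) ∈ R → a * w i < w j →
        qc a * (v i + qc (n i) * v i * eps ^ 3) < v j + qc (n j) * v j * eps ^ 3) ∧
      (∀ i j a, (i, j, a) ∈ R → a * w i = w j →
        qc a * (v i + qc (n i) * v i * eps ^ 3) = v j + qc (n j) * v j * eps ^ 3) := by
  obtain ⟨n, hn0, hnd, hlt, heq⟩ := rank_exists (fun i => qc (w i) / v i) r d hd
  refine ⟨n, hn0, hnd, fun i => pos_add_small (hv i) (hb i) (pert_small _ (hb i)), ?_, ?_⟩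
  · intro i j a ha h
    have h1 := hvR i j a ha h.le
    rcases h1.lt_or_eq with h1 | h1
    · have h2 : 0 < v j - qc a * v i := sub_pos.2 h1
      have h3 := pos_add_small h2 (band_sub (hb j) (band_qc_mul a (hb i)))
        (z := qc (n j) * v j * eps ^ 3 - qc a * (qc (n i) * v i * eps ^ 3)) (by
          intro m hm
          rw [HahnSeries.coeff_sub, coeff_qc_mul, pert_small _ (hb j) m hm,
            pert_small _ (hb i) m hm]; simp)
      linear_combination h3
    · have h2 : n i < n j := by
        apply hlt
        rw [div_lt_div_iff₀ (hv i) (hv j), ← h1]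
        have : qc (a * w i) < qc (w j) := qc_lt h
        rw [qc_mul] at this
        have := mul_lt_mul_of_pos_right this (hv i)
        linarith
      have h3 : qc (n i) < qc (n j) := qc_lt (by exact_mod_cast h2)
      have h4 : 0 < v j * eps ^ 3 := mul_pos (hv j) (pow_pos eps_pos 3)
      have h5 := mul_lt_mul_of_pos_right h3 h4
      have h6 : qc a * (v i + qc (n i) * v i * eps ^ 3) = v j + qc (n i) * (v j * eps ^ 3) := by
        rw [← h1]; ring
      rw [h6]
      linarith
  · intro i j a ha h
    have hapos := hR i j a ha
    have h1 : qc a * v i = v j := by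
      apply le_antisymm (hvR i j a ha h.le)
      have := hvR j i _ (hinv i j a ha) (by rw [← h, inv_mul_cancel_left₀ hapos.ne'])
      rw [qc_inv] at this
      rwa [inv_mul_le_iff₀ (qc_pos hapos)] at this
    have h2 : n i = n j := by
      apply heq
      rw [div_eq_div_iff (hv i).ne' (hv j).ne', ← h1, ← h, qc_mul]; ring
    rw [h2, ← h1]; ring

/-- Elements obtained from a constant by at most `n` multiplications or divisions by ratios. -/
def Form (HF KF : Finset ℚ) (n : ℕ) (x : Qstar) : Prop :=
  ∃ κ : Qstar, (κ = eps ∨ κ = eps⁻¹ ∨ ∃ k ∈ KF, κ = qc |k|) ∧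
    ∃ e : ℚ → ℤ, ∑ h ∈ HF, (e h).natAbs ≤ n ∧ x = κ * qc (∏ h ∈ HF, |h| ^ (e h))

lemma Form.mono {HF KF : Finset ℚ} {n m : ℕ} {x : Qstar} (h : Form HF KF n x) (hnm : n ≤ m) :
    Form HF KF m x := by
  obtain ⟨κ, hκ, e, he, hx⟩ := h
  exact ⟨κ, hκ, e, he.trans hnm, hx⟩

lemma Form.base {HF KF : Finset ℚ} {x : Qstar} (h : x = eps ∨ x = eps⁻¹ ∨ ∃ k ∈ KF, x = qc |k|) :
    Form HF KF 0 x := ⟨x, h, fun _ => 0, by simp, by simp [qc_one]⟩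

lemma Form.step {HF KF : Finset ℚ} {n : ℕ} {x : Qstar} (hf : Form HF KF n x) {h : ℚ}
    (hh : h ∈ HF) (h0 : h ≠ 0) (s : ℤ) (hs : s.natAbs ≤ 1) :
    Form HF KF (n + 1) (x * qc (|h| ^ s)) := by
  obtain ⟨κ, hκ, e, he, hx⟩ := hf
  refine ⟨κ, hκ, fun q => e q + if q = h then s else 0, ?_, ?_⟩
  · calc ∑ q ∈ HF, (e q + if q = h then s else 0).natAbs
        ≤ ∑ q ∈ HF, ((e q).natAbs + if q = h then 1 else 0) := by
          refine Finset.sum_le_sum fun q _ => ?_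
          split_ifs
          · omega
          · simp
      _ ≤ n + 1 := by
          rw [Finset.sum_add_distrib, Finset.sum_ite_eq', if_pos hh]; omega
  · rw [hx, mul_assoc, ← qc_mul]
    congr 2
    have h1 : |h| ^ s = ∏ q ∈ HF, |q| ^ (if q = h then s else 0) := by
      rw [Finset.prod_eq_single_of_mem h hh]
      · simp
      · intro b _ hb; simp [hb]
    rw [h1, ← Finset.prod_mul_distrib]
    refine Finset.prod_congr rfl fun q _ => ?_
    by_cases hq : q = h
    · rw [zpow_add₀ (by rw [hq]; exact abs_ne_zero.2 h0)]
    · simp [hq]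

lemma eps_inv : eps⁻¹ = HahnSeries.single (-1 : ℤ) (1 : ℚ) := by
  unfold eps; rw [HahnSeries.inv_single]; simp

lemma single_mul_qc (e : ℤ) (q p : ℚ) :
    (HahnSeries.single e q : Qstar) * qc p = HahnSeries.single e (q * p) := by
  rw [qc_eq_single, HahnSeries.single_mul_single, add_zero]

lemma Form.band {HF KF : Finset ℚ} {n : ℕ} {x : Qstar} (hf : Form HF KF n x) :
    x ∈ QstarBand (-1) 1 := by
  obtain ⟨κ, hκ, e, he, hx⟩ := hf
  rw [hx]
  rcases hκ with rfl | rfl | ⟨k, _, rfl⟩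
  · unfold eps; rw [single_mul_qc]; exact band_single _ (by norm_num) (by norm_num)
  · rw [eps_inv, single_mul_qc]; exact band_single _ (by norm_num) (by norm_num)
  · rw [← qc_mul]; exact band_qc _

/-- The rational comparison candidates. -/
def Cand {d : ℕ} (HF KF : Finset ℚ) : Option (Fin d) → Option (Fin d) → ℚ → Prop
  | some _, some _, a => ∃ h ∈ HF, a = |h| ∨ a = |h|⁻¹
  | none, some _, a => ∃ k ∈ KF, k ≠ 0 ∧ a = |k|
  | some _, none, a => ∃ k ∈ KF, k ≠ 0 ∧ a = |k|⁻¹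
  | none, none, _ => False

lemma cand_finset {d : ℕ} (HF KF : Finset ℚ) :
    ∃ R : Finset (Option (Fin d) × Option (Fin d) × ℚ),
      ∀ i j a, (i, j, a) ∈ R ↔ Cand HF KF i j a := by
  let A : Finset ℚ := HF.image (fun h => |h|) ∪ HF.image (fun h => |h|⁻¹) ∪
    KF.image (fun h => |h|) ∪ KF.image (fun h => |h|⁻¹)
  refine ⟨((Finset.univ : Finset (Option (Fin d))) ×ˢ ((Finset.univ : Finset (Option (Fin d))) ×ˢ A)).filter
    (fun e => Cand HF KF e.1 e.2.1 e.2.2), fun i j a => ?_⟩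
  simp only [Finset.mem_filter, Finset.mem_product, Finset.mem_univ, true_and,
    and_iff_right_iff_imp, A, Finset.mem_union, Finset.mem_image]
  intro h
  rcases i with _ | i <;> rcases j with _ | j <;> simp only [Cand] at h
  · obtain ⟨k, hk, _, rfl⟩ := h
    exact Or.inl (Or.inr ⟨k, hk, rfl⟩)
  · obtain ⟨k, hk, _, rfl⟩ := h
    exact Or.inr ⟨k, hk, rfl⟩
  · obtain ⟨k, hk, rfl | rfl⟩ := h
    · exact Or.inl (Or.inl (Or.inl ⟨k, hk, rfl⟩))
    · exact Or.inl (Or.inl (Or.inr ⟨k, hk, rfl⟩))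

lemma Cand.pos {d : ℕ} {HF KF : Finset ℚ} (hH : ∀ h ∈ HF, h ≠ 0) {i j : Option (Fin d)} {a : ℚ}
    (h : Cand HF KF i j a) : 0 < a := by
  rcases i with _ | i <;> rcases j with _ | j <;> simp only [Cand] at h
  · obtain ⟨k, hk, h0, rfl⟩ := h
    positivity
  · obtain ⟨k, hk, h0, rfl⟩ := h
    positivity
  · obtain ⟨k, hk, rfl | rfl⟩ := h
    · have := hH k hk; positivity
    · have := hH k hk; positivity

lemma Cand.inv {d : ℕ} {HF KF : Finset ℚ} {i j : Option (Fin d)} {a : ℚ}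
    (h : Cand HF KF i j a) : Cand HF KF j i a⁻¹ := by
  rcases i with _ | i <;> rcases j with _ | j <;> simp only [Cand] at h ⊢
  · obtain ⟨k, hk, h0, rfl⟩ := h
    exact ⟨k, hk, h0, rfl⟩
  · obtain ⟨k, hk, h0, rfl⟩ := h
    exact ⟨k, hk, h0, inv_inv _⟩
  · obtain ⟨k, hk, rfl | rfl⟩ := h
    · exact ⟨k, hk, Or.inr rfl⟩
    · exact ⟨k, hk, Or.inl (inv_inv _)⟩

lemma walk_form {d : ℕ} {HF KF : Finset ℚ} (hH : ∀ h ∈ HF, h ≠ 0)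
    (R : Finset (Option (Fin d) × Option (Fin d) × ℚ)) (hR : ∀ i j a, (i, j, a) ∈ R → Cand HF KF i j a)
    (w : Option (Fin d) → ℚ) (v : Option (Fin d) → Qstar) (hv : v none = 1) :
    ∀ (i r : Option (Fin d)) (p : (tightG (EE none w R) v).Walk i r), r = none → i ≠ none →
      Form HF KF (p.length - 1) (v i) := by
  intro i r p
  induction p with
  | nil => intro h1 h2; exact absurd h1 h2
  | @cons i j r hadj q ih =>
    intro hr hi
    have hadj' := hadj
    unfold tightG at hadj'
    rw [SimpleGraph.fromRel_adj] at hadj'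
    obtain ⟨hij, hadj'⟩ := hadj'
    simp only [mem_EE] at hadj'
    obtain ⟨i, rfl⟩ := Option.ne_none_iff_exists'.1 hi
    rcases j with _ | j
    · refine Form.mono (Form.base ?_) (Nat.zero_le _)
      rcases hadj' with ⟨b, (⟨a, ha, _, rfl⟩ | ⟨rfl, _⟩), hb⟩ | ⟨b, (⟨a, ha, _, rfl⟩ | ⟨rfl, _⟩), hb⟩
      · obtain ⟨k, hk, h0, rfl⟩ := hR _ _ _ ha
        right; right
        refine ⟨k, hk, ?_⟩
        rw [hv, qc_inv] at hb
        have : qc |k| ≠ 0 := (qc_pos (abs_pos.2 h0)).ne'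
        field_simp at hb
        exact hb
      · right; left
        rw [hv] at hb
        exact eq_inv_of_mul_eq_one_right hb
      · obtain ⟨k, hk, h0, rfl⟩ := hR _ _ _ ha
        right; right
        refine ⟨k, hk, ?_⟩
        rw [← hb, hv, mul_one]
      · left
        rw [← hb, hv, mul_one]
    · have hq : 1 ≤ q.length := by
        cases q with
        | nil => simp at hr
        | cons => simp
      have hF := ih hr (by simp)
      have key : ∃ h ∈ HF, ∃ s : ℤ, s.natAbs ≤ 1 ∧ v (some i) = v (some j) * qc (|h| ^ s) := by
        rcases hadj' with ⟨b, (⟨a, ha, _, rfl⟩ | ⟨rfl, _, h⟩), hb⟩ | ⟨b, (⟨a, ha, _, rfl⟩ | ⟨rfl, _, h⟩), hb⟩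
        · obtain ⟨h, hh, hor⟩ := hR _ _ _ ha
          have hp : qc |h| ≠ 0 := (qc_pos (abs_pos.2 (hH h hh))).ne'
          rcases hor with rfl | rfl
          · refine ⟨h, hh, -1, by simp, ?_⟩
            rw [zpow_neg_one, ← hb, qc_inv]
            field_simp
          · refine ⟨h, hh, 1, by simp, ?_⟩
            rw [zpow_one, ← hb, qc_inv]
            field_simp
        · simp at h
        · obtain ⟨h, hh, hor⟩ := hR _ _ _ ha
          rcases hor with rfl | rfl
          · refine ⟨h, hh, 1, by simp, ?_⟩
            rw [zpow_one, ← hb, mul_comm]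
          · refine ⟨h, hh, -1, by simp, ?_⟩
            rw [zpow_neg_one, ← hb, mul_comm]
        · simp at h
      obtain ⟨h, hh, s, hs, hvi⟩ := key
      rw [hvi]
      refine (hF.step hh (hH h hh) s hs).mono ?_
      rw [SimpleGraph.Walk.length_cons]
      omega

lemma vertex_form {d : ℕ} {HF KF : Finset ℚ} (hH : ∀ h ∈ HF, h ≠ 0)
    (R : Finset (Option (Fin d) × Option (Fin d) × ℚ)) (hR : ∀ i j a, (i, j, a) ∈ R → Cand HF KF i j a)
    (w : Option (Fin d) → ℚ) (v : Option (Fin d) → Qstar) (hv : v none = 1)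
    (hreach : ∀ i, (tightG (EE none w R) v).Reachable i none) (i : Fin d) :
    Form HF KF (d - 1) (v (some i)) := by
  obtain ⟨p, hp⟩ := (hreach (some i)).exists_isPath
  have := hp.length_lt
  rw [Fintype.card_option, Fintype.card_fin] at this
  exact (walk_form hH R hR w v hv _ _ p rfl (by simp)).mono (by omega)

lemma combined {d : ℕ} {HF KF : Finset ℚ} (hH : ∀ h ∈ HF, h ≠ 0)
    (w : Option (Fin d) → ℚ) (hw : ∀ i, 0 < w i) (hw1 : w none = 1)
    (c : Option (Fin d) → ℚ) (u : ℚ) (hu : ∑ i, c i * w i ≤ u) :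
    ∃ (v : Option (Fin d) → Qstar) (n : Option (Fin d) → ℤ) (v' : Option (Fin d) → Qstar),
      (∀ i, v' i = v i + qc (n i) * v i * eps ^ 3) ∧
      (∀ i, Form HF KF (d - 1) (v (some i))) ∧ v' none = 1 ∧
      (∀ i, -(d : ℤ) ≤ n i ∧ n i ≤ d) ∧ (∀ i, 0 < v' i) ∧
      (∀ i j a, Cand HF KF i j a → a * w i < w j → qc a * v' i < v' j) ∧
      (∀ i j a, Cand HF KF i j a → a * w i = w j → qc a * v' i = v' j) ∧
      ∑ i, qc (c i) * v' i ≤ qc u := by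
  obtain ⟨R, hR⟩ := cand_finset (d := d) HF KF
  have hRp : ∀ i j a, (i, j, a) ∈ R → 0 < a := fun i j a h => ((hR i j a).1 h).pos hH
  have hRi : ∀ i j a, (i, j, a) ∈ R → (j, i, a⁻¹) ∈ R := fun i j a h =>
    (hR _ _ _).2 ((hR i j a).1 h).inv
  have hRc : ∀ i j a, (i, j, a) ∈ R → Cand HF KF i j a := fun i j a h => (hR i j a).1 h
  have hcard : Fintype.card (Option (Fin d)) ≤ d + 1 := by
    rw [Fintype.card_option, Fintype.card_fin]
  have main : ∀ w' : Option (Fin d) → ℚ, (∀ i, 0 < w' i) → w' none = 1 →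
      ∃ (v : Option (Fin d) → Qstar) (n : Option (Fin d) → ℤ) (v' : Option (Fin d) → Qstar),
      (∀ i, v' i = v i + qc (n i) * v i * eps ^ 3) ∧
      (∀ i, Form HF KF (d - 1) (v (some i))) ∧ v' none = 1 ∧
      (∀ i, -(d : ℤ) ≤ n i ∧ n i ≤ d) ∧ (∀ i, 0 < v' i) ∧
      (∀ i j a, (i, j, a) ∈ R → a * w' i < w' j → qc a * v' i < v' j) ∧
      (∀ i j a, (i, j, a) ∈ R → a * w' i = w' j → qc a * v' i = v' j) ∧
      (∀ i, v i ∈ QstarBand (-1) 1) ∧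
      ∑ i, qc (c i) * v i ≤ qc (∑ i, c i * w' i) := by
    intro w' hw' hw1'
    obtain ⟨v, h1, h2, h3, h4, h5⟩ := qstar_vertex none w' hw' hw1' R hRp c
    have hform := vertex_form hH R hRc w' v h2 h5
    have hband : ∀ i, v i ∈ QstarBand (-1) 1 := by
      intro i
      rcases i with _ | i
      · rw [h2, ← qc_one]; exact band_qc 1
      · exact (hform i).band
    obtain ⟨n, g1, g2, g3, g4, g5⟩ := perturb none w' R hRp hRi v h1 hband h3 d hcard
    refine ⟨v, n, fun i => v i + qc (n i) * v i * eps ^ 3, fun i => rfl, hform, ?_, g2, g3, g4, g5,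
      hband, h4⟩
    simp [g1, h2, qc_zero]
  rcases move_cases none w hw hw1 R c u hu with hA | ⟨w', hw', hw1', hlt, heq, hobj⟩
  · obtain ⟨v, n, v', e1, e2, e3, e4, e5, e6, e7, e8, e9⟩ := main w hw hw1
    refine ⟨v, n, v', e1, e2, e3, e4, e5, fun i j a h => e6 i j a ((hR _ _ _).2 h),
      fun i j a h => e7 i j a ((hR _ _ _).2 h), ?_⟩
    have hz : ∑ i, qc (c i) * (v' i - qc (w i)) = 0 := by
      ext m
      rw [HahnSeries.coeff_sum]
      simp only [coeff_qc_mul, HahnSeries.coeff_zero]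
      apply hA (fun i => (v' i - qc (w i)).coeff m)
      · rw [e3, hw1, qc_one]; simp
      · intro i j a ha h
        have h1 := e7 i j a ha h
        rw [← coeff_qc_mul, ← h1, ← h, qc_mul]
        congr 1; ring
    have hs : ∑ i, qc (c i) * v' i = qc (∑ i, c i * w i) := by
      rw [qc_sum, ← sub_eq_zero, ← Finset.sum_sub_distrib, ← hz]
      refine Finset.sum_congr rfl fun i _ => ?_
      rw [qc_mul]; ring
    rw [hs]
    exact qc_le_iff.2 hu
  · obtain ⟨v, n, v', e1, e2, e3, e4, e5, e6, e7, e8, e9⟩ := main w' hw' hw1'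
    refine ⟨v, n, v', e1, e2, e3, e4, e5,
      fun i j a h h' => e6 i j a ((hR _ _ _).2 h) (hlt i j a ((hR _ _ _).2 h) h'),
      fun i j a h h' => e7 i j a ((hR _ _ _).2 h) (heq i j a ((hR _ _ _).2 h) h'), ?_⟩
    have h1 : 0 < qc u - ∑ i, qc (c i) * v i := sub_pos.2 (e9.trans_lt (qc_lt hobj))
    have h2 := pos_add_small h1
      (band_sub (band_qc u) (band_sum _ _ fun i _ => band_qc_mul (c i) (e8 i)))
      (z := - ∑ i, qc (c i) * (qc (n i) * v i * eps ^ 3)) (by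
        intro m hm
        rw [HahnSeries.coeff_neg, HahnSeries.coeff_sum, neg_eq_zero]
        refine Finset.sum_eq_zero fun i _ => ?_
        rw [coeff_qc_mul, pert_small _ (e8 i) m hm, mul_zero])
    have h3 : ∑ i, qc (c i) * v' i
        = ∑ i, qc (c i) * v i + ∑ i, qc (c i) * (qc (n i) * v i * eps ^ 3) := by
      rw [← Finset.sum_add_distrib]
      refine Finset.sum_congr rfl fun i _ => ?_
      rw [e1]; ring
    rw [h3]
    linarith

lemma Hset_finite {d : ℕ} (Φ : Finset (Atom d)) : (Hset Φ).Finite := by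
  let f : Atom d → ℚ := fun a => match a with
    | .vv c₁ c₂ _ _ _ => c₁ / c₂
    | .vk _ _ _ _ => 0
    | .kv _ _ _ _ => 0
  refine (Φ.image f).finite_toSet.subset ?_
  rintro h ⟨c₁, c₂, i, j, s, ha, rfl⟩
  simp only [Finset.coe_image, Set.mem_image, Finset.mem_coe]
  exact ⟨_, ha, rfl⟩

lemma Kset_finite {d : ℕ} (Φ : Finset (Atom d)) : (Kset Φ).Finite := by
  let f : Atom d → ℚ := fun a => match a with
    | .vv _ _ _ _ _ => 0
    | .vk c k _ _ => k / c
    | .kv k c _ _ => k / c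
  refine (Φ.image f).finite_toSet.subset ?_
  rintro h ⟨c, k, i, s, ha | ha, rfl⟩
  all_goals
    simp only [Finset.coe_image, Set.mem_image, Finset.mem_coe]
    exact ⟨_, ha, rfl⟩

lemma cmp_transfer (A B p q : ℚ) (P Q : Qstar) (hp : 0 < p) (hq : 0 < q) (hP : 0 < P) (hQ : 0 < Q)
    (h : A ≠ 0 → B ≠ 0 → (|A| / |B| * p < q → qc (|A| / |B|) * P < Q) ∧
      (|A| / |B| * p = q → qc (|A| / |B|) * P = Q) ∧
      (q < |A| / |B| * p → Q < qc (|A| / |B|) * P)) :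
    (A * p < B * q → qc A * P < qc B * Q) ∧ (A * p = B * q → qc A * P = qc B * Q) := by
  have key : ∀ A B : ℚ, 0 < A → 0 < B → ((A / B * p < q → qc (A / B) * P < Q) ∧
      (A / B * p = q → qc (A / B) * P = Q) ∧ (q < A / B * p → Q < qc (A / B) * P)) →
      (A * p < B * q → qc A * P < qc B * Q) ∧ (A * p = B * q → qc A * P = qc B * Q) ∧
      (B * q < A * p → qc B * Q < qc A * P) := by
    intro A B hA hB h
    have e1 : A * p = B * (A / B * p) := by field_simp
    have e2 : qc A * P = qc B * (qc (A / B) * P) := by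
      rw [← mul_assoc, ← qc_mul]; congr 2; field_simp
    rw [e1, e2]
    have hB' := qc_pos hB
    refine ⟨fun g => ?_, fun g => ?_, fun g => ?_⟩
    · exact mul_lt_mul_of_pos_left (h.1 (lt_of_mul_lt_mul_left g hB.le)) hB'
    · rw [h.2.1 (mul_left_cancel₀ hB.ne' g)]
    · exact mul_lt_mul_of_pos_left (h.2.2 (lt_of_mul_lt_mul_left g hB.le)) hB'
  have npos : ∀ {a : ℚ}, a < 0 → qc a < 0 := fun ha => by rw [← qc_zero]; exact qc_lt ha
  rcases lt_trichotomy A 0 with hA | hA | hA <;> rcases lt_trichotomy B 0 with hB | hB | hB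
  · have h' := h hA.ne hB.ne
    rw [abs_of_neg hA, abs_of_neg hB] at h'
    obtain ⟨k1, k2, k3⟩ := key (-A) (-B) (by linarith) (by linarith) h'
    rw [qc_neg, qc_neg] at k1 k2 k3
    constructor
    · intro g
      have := k3 (by linarith)
      linarith
    · intro g
      have := k2 (by linarith)
      linarith
  · subst hB
    rw [qc_zero, zero_mul, zero_mul]
    have h1 := mul_neg_of_neg_of_pos (npos hA) hP
    have h2 := mul_neg_of_neg_of_pos hA hp
    exact ⟨fun _ => h1, fun g => absurd g h2.ne⟩
  · have h1 := mul_neg_of_neg_of_pos (npos hA) hP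
    have h2 := mul_neg_of_neg_of_pos hA hp
    have h3 := mul_pos (qc_pos hB) hQ
    have h4 := mul_pos hB hq
    exact ⟨fun _ => h1.trans h3, fun g => absurd g (h2.trans h4).ne⟩
  · subst hA
    rw [qc_zero, zero_mul, zero_mul]
    have h2 := mul_neg_of_neg_of_pos hB hq
    exact ⟨fun g => absurd g h2.not_gt, fun g => absurd g h2.ne'⟩
  · subst hA hB
    simp [qc_zero]
  · subst hA
    rw [qc_zero, zero_mul, zero_mul]
    have h3 := mul_pos (qc_pos hB) hQ
    have h4 := mul_pos hB hq
    exact ⟨fun _ => h3, fun g => absurd g h4.ne⟩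
  · have h2 := mul_neg_of_neg_of_pos hB hq
    have h4 := mul_pos hA hp
    exact ⟨fun g => absurd g (h2.trans h4).not_gt, fun g => absurd g (h2.trans h4).ne'⟩
  · subst hB
    rw [qc_zero, zero_mul, zero_mul]
    have h4 := mul_pos hA hp
    exact ⟨fun g => absurd g h4.not_gt, fun g => absurd g h4.ne'⟩
  · have h' := h hA.ne' hB.ne'
    rw [abs_of_pos hA, abs_of_pos hB] at h'
    obtain ⟨k1, k2, k3⟩ := key A B hA hB h'
    exact ⟨k1, k2⟩

lemma form_mem_Cset' {d : ℕ} (hd : 1 ≤ d) (Φ : Finset (Atom d)) (x : Qstar)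
    (h : Form (Hset_finite Φ).toFinset (Kset_finite Φ).toFinset (d - 1) x) : x ∈ Cset' Φ := by
  obtain ⟨κ, hκ, e, he, hx⟩ := h
  have hκ' : ∃ k ∈ Kset' Φ, qabs k = κ := by
    rcases hκ with rfl | rfl | ⟨k, hk, rfl⟩
    · exact ⟨eps, Or.inr (Or.inr (Or.inl rfl)), by rw [qabs_eq, abs_of_pos eps_pos]⟩
    · exact ⟨eps⁻¹, Or.inr (Or.inr (Or.inr rfl)), by
        rw [qabs_eq, abs_of_pos (inv_pos.2 eps_pos)]⟩
    · exact ⟨qc k, Or.inl ⟨k, (Set.Finite.mem_toFinset _).1 hk, rfl⟩, by rw [qabs_eq, qc_abs]⟩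
  obtain ⟨k, hk, rfl⟩ := hκ'
  set HF := (Hset_finite Φ).toFinset with hHF
  refine ⟨k, hk, HF.card, fun r => (HF.equivFin.symm r : ℚ), fun r => e (HF.equivFin.symm r : ℚ),
    ?_, ?_, ?_, ?_⟩
  · exact Subtype.val_injective.comp HF.equivFin.symm.injective
  · intro q
    constructor
    · intro hq
      refine ⟨HF.equivFin ⟨q, (Set.Finite.mem_toFinset _).2 hq⟩, by simp⟩
    · rintro ⟨r, rfl⟩
      exact (Set.Finite.mem_toFinset _).1 (HF.equivFin.symm r).2
  · rw [Equiv.sum_comp HF.equivFin.symm (fun q : HF => (e (q : ℚ)).natAbs),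
      Finset.sum_coe_sort HF (fun q => (e q).natAbs)]
    omega
  · rw [Equiv.prod_comp HF.equivFin.symm (fun q : HF => |(q : ℚ)| ^ (e (q : ℚ))),
      Finset.prod_coe_sort HF (fun q => |q| ^ (e q))]
    exact hx

lemma forward {d : ℕ} (hd : 1 ≤ d)
    (Φ : Finset (Atom d)) (hwf : ∀ a ∈ Φ, a.WellFormed)
    (α : Fin d → ℚ) (u : ℚ) (x : Fin d → ℚ) (hx : ∀ a ∈ Φ, a.Holds (· < ·) x)
    (hu : (∑ i, α i * x i) ≤ u) :
    (∃ y : Fin d → Qstar, (∀ i, y i ∈ Dset' Φ) ∧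
      (∀ a ∈ Φ, a.HoldsStar QstarLt y) ∧
      QstarLe (∑ i, qc (α i) * y i) (qc u)) := by
  set HF := (Hset_finite Φ).toFinset with hHF
  set KF := (Kset_finite Φ).toFinset with hKF
  have hH : ∀ h ∈ HF, h ≠ 0 := by
    intro h hh
    rw [hHF, Set.Finite.mem_toFinset] at hh
    obtain ⟨c₁, c₂, i, j, s, ha, rfl⟩ := hh
    have := hwf _ ha
    exact div_ne_zero this.1 this.2.1
  obtain ⟨σ, w, hσ, hw, hxw⟩ : ∃ (σ w : Fin d → ℚ), (∀ i, σ i = -1 ∨ σ i = 0 ∨ σ i = 1) ∧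
      (∀ i, 0 < w i) ∧ ∀ i, x i = σ i * w i := by
    have : ∀ i, ∃ s w : ℚ, (s = -1 ∨ s = 0 ∨ s = 1) ∧ 0 < w ∧ x i = s * w := by
      intro i
      rcases lt_trichotomy (x i) 0 with h | h | h
      · exact ⟨-1, -x i, by simp, by linarith, by ring⟩
      · exact ⟨0, 1, by simp, by simp, by simp [h]⟩
      · exact ⟨1, x i, by simp, h, by ring⟩
    choose s w h1 h2 h3 using this
    exact ⟨s, w, h1, h2, h3⟩
  have hσabs : ∀ i, σ i ≠ 0 → |σ i| = 1 := by
    intro i hi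
    rcases hσ i with h | h | h
    · rw [h]; norm_num
    · exact absurd h hi
    · rw [h]; norm_num
  let w' : Option (Fin d) → ℚ := fun o => o.elim 1 w
  have hw' : ∀ i, 0 < w' i := by
    intro i; rcases i with _ | i
    · exact one_pos
    · exact hw i
  obtain ⟨v, n, v', e1, e2, e3, e4, e5, e6, e7, e8⟩ := combined (HF := HF) (KF := KF) hH w' hw' rfl
    (fun o => o.elim 0 (fun i => α i * σ i)) u (by
      rw [Fintype.sum_option]
      simp only [Option.elim, zero_mul, zero_add, w']
      refine le_of_eq_of_le (Finset.sum_congr rfl fun i _ => ?_) hu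
      rw [hxw i]; ring)
  have trans : ∀ (i j : Option (Fin d)) (A B : ℚ), (A ≠ 0 → B ≠ 0 → Cand HF KF i j (|A| / |B|)) →
      (A * w' i < B * w' j → qc A * v' i < qc B * v' j) ∧
      (A * w' i = B * w' j → qc A * v' i = qc B * v' j) := by
    intro i j A B hC
    refine cmp_transfer A B _ _ _ _ (hw' i) (hw' j) (e5 i) (e5 j) fun hA hB => ?_
    have hc := hC hA hB
    refine ⟨e6 i j _ hc, e7 i j _ hc, fun h => ?_⟩
    have hp := hc.pos hH
    have := e6 j i _ hc.inv (by rwa [inv_mul_lt_iff₀ hp])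
    rwa [qc_inv, inv_mul_lt_iff₀ (qc_pos hp)] at this
  refine ⟨fun i => qc (σ i) * v' (some i), fun i => ?_, ?_, ?_⟩
  · have hm : v' (some i) ∈ CstarSet' Φ :=
      ⟨v (some i), form_mem_Cset' hd Φ _ (e2 i), n (some i), (e4 _).1, (e4 _).2, e1 _⟩
    rcases hσ i with h | h | h
    · exact Or.inl ⟨_, hm, by simp only [h, qc_neg, qc_one]; ring⟩
    · exact Or.inr (Or.inl (by simp only [h, qc_zero, zero_mul]))
    · refine Or.inr (Or.inr ?_)
      simp only [h, qc_one, one_mul]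
      exact hm
  · intro a ha
    have hax := hx a ha
    have haw := hwf a ha
    cases a with
    | vv c₁ c₂ i j s =>
      have ht := trans (some i) (some j) (c₁ * σ i) (c₂ * σ j) (by
        intro h1 h2
        refine ⟨c₁ / c₂, ?_, Or.inl ?_⟩
        · rw [hHF, Set.Finite.mem_toFinset]; exact ⟨c₁, c₂, i, j, s, ha, rfl⟩
        · rw [abs_mul, abs_mul, hσabs i (right_ne_zero_of_mul h1),
            hσabs j (right_ne_zero_of_mul h2), abs_div, mul_one, mul_one])
      simp only [Atom.Holds, hxw, Atom.HoldsStar, qlt_iff, w', Option.elim, qc_mul, mul_assoc] at hax ht ⊢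
      cases s
      · simp only [Bool.false_eq_true, if_false] at hax ⊢; exact ht.2 hax
      · simp only [if_true] at hax ⊢; exact ht.1 hax
    | vk c k i s =>
      have ht := trans (some i) none (c * σ i) k (by
        intro h1 h2
        refine ⟨k / c, ?_, div_ne_zero h2 (left_ne_zero_of_mul h1), ?_⟩
        · rw [hKF, Set.Finite.mem_toFinset]; exact ⟨c, k, i, s, Or.inl ha, rfl⟩
        · rw [abs_mul, hσabs i (right_ne_zero_of_mul h1), abs_div, mul_one, inv_div])
      simp only [Atom.Holds, hxw, Atom.HoldsStar, qlt_iff, w', Option.elim, qc_mul, mul_assoc, e3,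
        mul_one] at hax ht ⊢
      cases s
      · simp only [Bool.false_eq_true, if_false] at hax ⊢; exact ht.2 hax
      · simp only [if_true] at hax ⊢; exact ht.1 hax
    | kv k c i s =>
      have ht := trans none (some i) k (c * σ i) (by
        intro h1 h2
        refine ⟨k / c, ?_, div_ne_zero h1 (left_ne_zero_of_mul h2), ?_⟩
        · rw [hKF, Set.Finite.mem_toFinset]; exact ⟨c, k, i, s, Or.inr ha, rfl⟩
        · rw [abs_mul, hσabs i (right_ne_zero_of_mul h2), abs_div, mul_one])
      simp only [Atom.Holds, hxw, Atom.HoldsStar, qlt_iff, w', Option.elim, qc_mul, mul_assoc, e3,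
        mul_one] at hax ht ⊢
      cases s
      · simp only [Bool.false_eq_true, if_false] at hax ⊢; exact ht.2 hax
      · simp only [if_true] at hax ⊢; exact ht.1 hax
  · rw [qle_iff]
    rw [Fintype.sum_option] at e8
    simp only [Option.elim, qc_zero, zero_mul, zero_add, qc_mul, mul_assoc] at e8
    exact e8

/-- Evaluation of (band-limited) Laurent polynomials at a rational point. -/
def evq (t : ℚ) (y : Qstar) : ℚ := t⁻¹ * ∑ k ∈ Finset.range 6, y.coeff ((k : ℤ) - 1) * t ^ k

lemma evq_sub (t : ℚ) (x y : Qstar) : evq t (x - y) = evq t x - evq t y := by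
  unfold evq
  rw [← mul_sub, ← Finset.sum_sub_distrib]
  congr 1
  refine Finset.sum_congr rfl fun k _ => ?_
  rw [HahnSeries.coeff_sub]; ring

lemma evq_qc_mul (t c : ℚ) (y : Qstar) : evq t (qc c * y) = c * evq t y := by
  unfold evq
  simp only [coeff_qc_mul, Finset.mul_sum]
  refine Finset.sum_congr rfl fun k _ => ?_
  ring

lemma evq_sum {ι : Type*} (s : Finset ι) (t : ℚ) (f : ι → Qstar) :
    evq t (∑ i ∈ s, f i) = ∑ i ∈ s, evq t (f i) := by
  unfold evq
  rw [← Finset.mul_sum, Finset.sum_comm]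
  congr 1
  refine Finset.sum_congr rfl fun k _ => ?_
  rw [HahnSeries.coeff_sum, Finset.sum_mul]

lemma evq_qc {t : ℚ} (ht : 0 < t) (c : ℚ) : evq t (qc c) = c := by
  unfold evq
  rw [Finset.sum_eq_single 1]
  · simp only [qc_eq_single]
    simp
    field_simp
  · intro b _ hb
    rw [qc_eq_single, HahnSeries.coeff_single_of_ne (by omega), zero_mul]
  · simp

lemma evq_eventually_pos {y : Qstar} (hb : y ∈ QstarBand (-1) 4) (hy : 0 < y) :
    ∀ᶠ t in nhdsWithin (0 : ℚ) (Set.Ioi 0), 0 < evq t y := by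
  rw [qpos_iff] at hy
  obtain ⟨m, hm, h⟩ := hy
  have hmb := hb m hm.ne'
  have := eventually_poly_pos 6 (fun k => y.coeff ((k : ℤ) - 1)) (m + 1).toNat (by omega)
    (by
      have e : (((m + 1).toNat : ℕ) : ℤ) - 1 = m := by omega
      simp only [e]; exact hm)
    (fun i hi => h _ (by omega))
  filter_upwards [this, self_mem_nhdsWithin] with t ht ht0
  exact mul_pos (inv_pos.2 ht0) ht

lemma evq_eventually_lt {x y : Qstar} (hx : x ∈ QstarBand (-1) 4) (hy : y ∈ QstarBand (-1) 4)
    (h : x < y) : ∀ᶠ t in nhdsWithin (0 : ℚ) (Set.Ioi 0), evq t x < evq t y := by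
  filter_upwards [evq_eventually_pos (band_sub hy hx) (sub_pos.2 h)] with t ht
  rw [evq_sub] at ht
  linarith

lemma band_Cset' {d : ℕ} {Φ : Finset (Atom d)} {x : Qstar} (hx : x ∈ Cset' Φ) :
    x ∈ QstarBand (-1) 1 := by
  obtain ⟨k, hk, s, h, e, _, _, _, rfl⟩ := hx
  rw [mul_comm]
  apply band_qc_mul
  rw [qabs_eq]
  rcases hk with ⟨k, _, rfl⟩ | rfl | rfl | rfl
  · rw [qc_abs]; exact band_qc _
  · rw [← qc_one, qc_abs]; exact band_qc _
  · rw [abs_of_pos eps_pos]; exact band_single _ (by norm_num) (by norm_num)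
  · rw [abs_of_pos (inv_pos.2 eps_pos), eps_inv]; exact band_single _ (by norm_num) (by norm_num)

lemma band_Cstar {d : ℕ} {Φ : Finset (Atom d)} {x : Qstar} (hx : x ∈ CstarSet' Φ) :
    x ∈ QstarBand (-1) 4 := by
  obtain ⟨x, hx, n, _, _, rfl⟩ := hx
  intro i hi
  rw [HahnSeries.coeff_add, coeff_mul_eps3, coeff_qc_mul] at hi
  by_cases h : x.coeff i = 0
  · rw [h, zero_add] at hi
    have := band_Cset' hx _ (right_ne_zero_of_mul hi)
    omega
  · have := band_Cset' hx _ h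
    omega

lemma band_Dset {d : ℕ} {Φ : Finset (Atom d)} {x : Qstar} (hx : x ∈ Dset' Φ) :
    x ∈ QstarBand (-1) 4 := by
  rcases hx with ⟨z, hz, rfl⟩ | rfl | hx
  · have := band_qc_mul (-1) (band_Cstar hz)
    rwa [qc_neg, qc_one, neg_one_mul] at this
  · intro i hi; simp at hi
  · exact band_Cstar hx

lemma band_qc4 (q : ℚ) : qc q ∈ QstarBand (-1) 4 := band_single q (by norm_num) (by norm_num)

lemma backward {d : ℕ} (Φ : Finset (Atom d)) (α : Fin d → ℚ) (u : ℚ) (y : Fin d → Qstar)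
    (hD : ∀ i, y i ∈ Dset' Φ) (hy : ∀ a ∈ Φ, a.HoldsStar QstarLt y)
    (hu : QstarLe (∑ i, qc (α i) * y i) (qc u)) :
    ∃ x : Fin d → ℚ, (∀ a ∈ Φ, a.Holds (· < ·) x) ∧ (∑ i, α i * x i) ≤ u := by
  have hb : ∀ i, y i ∈ QstarBand (-1) 4 := fun i => band_Dset (hD i)
  have ev1 : ∀ᶠ t in nhdsWithin (0 : ℚ) (Set.Ioi 0), ∀ a ∈ Φ, a.Holds (· < ·) (fun i => evq t (y i)) := by
    rw [Filter.eventually_all_finset]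
    intro a ha
    have hya := hy a ha
    cases a with
    | vv c₁ c₂ i j s =>
      cases s
      · simp only [Atom.HoldsStar, Atom.Holds, Bool.false_eq_true, if_false] at hya ⊢
        refine Filter.Eventually.of_forall fun t => ?_
        rw [← evq_qc_mul, ← evq_qc_mul, hya]
      · simp only [Atom.HoldsStar, Atom.Holds, if_true, qlt_iff] at hya ⊢
        filter_upwards [evq_eventually_lt (band_qc_mul _ (hb i)) (band_qc_mul _ (hb j)) hya] with t ht
        rwa [evq_qc_mul, evq_qc_mul] at ht
    | vk c k i s =>
      cases s
      · simp only [Atom.HoldsStar, Atom.Holds, Bool.false_eq_true, if_false] at hya ⊢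
        filter_upwards [self_mem_nhdsWithin] with t ht
        rw [← evq_qc_mul, hya, evq_qc ht]
      · simp only [Atom.HoldsStar, Atom.Holds, if_true, qlt_iff] at hya ⊢
        filter_upwards [evq_eventually_lt (band_qc_mul _ (hb i)) (band_qc4 k) hya,
          self_mem_nhdsWithin] with t ht ht0
        rwa [evq_qc_mul, evq_qc ht0] at ht
    | kv k c i s =>
      cases s
      · simp only [Atom.HoldsStar, Atom.Holds, Bool.false_eq_true, if_false] at hya ⊢
        filter_upwards [self_mem_nhdsWithin] with t ht
        rw [← evq_qc_mul, ← hya, evq_qc ht]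
      · simp only [Atom.HoldsStar, Atom.Holds, if_true, qlt_iff] at hya ⊢
        filter_upwards [evq_eventually_lt (band_qc4 k) (band_qc_mul _ (hb i)) hya,
          self_mem_nhdsWithin] with t ht ht0
        rwa [evq_qc_mul, evq_qc ht0] at ht
  have ev2 : ∀ᶠ t in nhdsWithin (0 : ℚ) (Set.Ioi 0), ∑ i, α i * evq t (y i) ≤ u := by
    have e : ∀ t, ∑ i, α i * evq t (y i) = evq t (∑ i, qc (α i) * y i) := by
      intro t; rw [evq_sum]; simp only [evq_qc_mul]
    simp only [e]
    rcases hu with hu | hu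
    · rw [qlt_iff] at hu
      filter_upwards [evq_eventually_lt (band_sum _ _ fun i _ => band_qc_mul _ (hb i)) (band_qc4 u) hu,
          self_mem_nhdsWithin] with t ht ht0
      rw [evq_qc ht0] at ht
      exact ht.le
    · filter_upwards [self_mem_nhdsWithin] with t ht
      rw [hu, evq_qc ht]
  obtain ⟨t, h1, h2⟩ := (ev1.and ev2).exists
  exact ⟨_, h1, h2⟩

/-- `Φ` has a rational solution with `Σ αᵢxᵢ ≤ u` if and only if `Φ`,
interpreted in `ℚ((ε))`, has a solution in `D^d` with `Σ αᵢx'ᵢ ≤ u`. -/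
theorem rational_solution_iff_Dstar_solution {d : ℕ} (hd : 1 ≤ d)
    (Φ : Finset (Atom d)) (hwf : ∀ a ∈ Φ, a.WellFormed)
    (α : Fin d → ℚ) (u : ℚ) :
    (∃ x : Fin d → ℚ, (∀ a ∈ Φ, a.Holds (· < ·) x) ∧ (∑ i, α i * x i) ≤ u) ↔
    (∃ y : Fin d → Qstar, (∀ i, y i ∈ Dset' Φ) ∧
      (∀ a ∈ Φ, a.HoldsStar QstarLt y) ∧
      QstarLe (∑ i, qc (α i) * y i) (qc u)) := by
  constructor
  · rintro ⟨x, hx, hu⟩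
    exact forward hd Φ hwf α u x hx hu
  · rintro ⟨y, hD, hy, hu⟩
    exact backward Φ α u y hD hy hu
end

section
/- Let Δ and Γ be valued τ-structures with domains D and C respectively, and suppose there is a fractional homomorphism from Δ to Γ. Let I be an instance over τ with variable set V, objective φ, and let u ∈ ℚ. If there exists an assignment h : V → D with φ^Δ(h) ≤ u, then there exists an assignment h' : V → C with φ^Γ(h') ≤ u. In particular, inf_{h' : V → C} φ^Γ(h') ≤ inf_{h : V → D} φ^Δ(h). -/
open scoped Classical

/-- Costs: `ℚ ∪ {+∞}`, with `c + ∞ = ∞`, `q·∞ = ∞` for `q > 0` and `0·∞ = 0`. -/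
abbrev Cost : Type := WithTop ℚ

/-- A valued structure with signature `τ` (a type of function symbols, `f : τ`
having arity `ar f`) and domain `C`: each symbol is interpreted as a cost
function `C^{ar f} → ℚ ∪ {+∞}`. -/
structure VStruct (τ : Type*) (ar : τ → ℕ) (C : Type*) where
  interp : ∀ f : τ, (Fin (ar f) → C) → Cost

/-- The cost `φ^Γ(h)` of an assignment `h : V → C` for the objective function
`φ = Σ_{j<m} f_j(x^j)` given by the symbols `F j` and variable tuples `X j`. -/
def objCost {τ : Type*} {ar : τ → ℕ} {C V : Type*} (Γ : VStruct τ ar C)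
    {m : ℕ} (F : Fin m → τ) (X : ∀ j : Fin m, Fin (ar (F j)) → V)
    (h : V → C) : Cost :=
  ∑ j, Γ.interp (F j) (fun l => h (X j l))

/-- A fractional homomorphism from `Δ` to `Γ`: a finitely supported
probability distribution `ω` on maps `D → C` such that
`Σ_g ω(g)·f^Γ(g∘a) ≤ f^Δ(a)` for every symbol `f` and tuple `a`. -/
structure FracHom {τ : Type*} {ar : τ → ℕ} {D C : Type*}
    (Δ : VStruct τ ar D) (Γ : VStruct τ ar C) where
  w : (D → C) →₀ ℚ
  nonneg : ∀ g, 0 ≤ w g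
  sum_one : ∑ g ∈ w.support, w g = 1
  le : ∀ (f : τ) (a : Fin (ar f) → D),
    ∑ g ∈ w.support, ((w g : ℚ) : Cost) * Γ.interp f (fun l => g (a l))
      ≤ Δ.interp f a

/-- If there is a fractional homomorphism from `Δ` to `Γ` and an instance has
an assignment into the domain of `Δ` of cost at most `u`, then it also has an
assignment into the domain of `Γ` of cost at most `u`. -/
theorem fracHom_preserves_threshold {τ : Type*} {ar : τ → ℕ} {D C V : Type*}
    (Δ : VStruct τ ar D) (Γ : VStruct τ ar C) (ω : FracHom Δ Γ)
    {m : ℕ} (F : Fin m → τ) (X : ∀ j : Fin m, Fin (ar (F j)) → V) (u : ℚ)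
    (h : V → D) (hcost : objCost Δ F X h ≤ (u : Cost)) :
    ∃ h' : V → C, objCost Γ F X h' ≤ (u : Cost) := by
  have h1 : ∑ j, ∑ g ∈ ω.w.support, ((ω.w g : ℚ) : Cost) *
      Γ.interp (F j) (fun l => g (h (X j l))) ≤ (u : Cost) :=
    le_trans (Finset.sum_le_sum fun j _ => ω.le (F j) (fun l => h (X j l))) hcost
  have hfin : ∀ j, ∀ g ∈ ω.w.support, Γ.interp (F j) (fun l => g (h (X j l))) ≠ ⊤ := by
    intro j g hg htop
    have hne : ∑ j, ∑ g ∈ ω.w.support, ((ω.w g : ℚ) : Cost) *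
        Γ.interp (F j) (fun l => g (h (X j l))) ≠ ⊤ :=
      ne_of_lt (lt_of_le_of_lt h1 (WithTop.coe_lt_top u))
    apply hne
    rw [WithTop.sum_eq_top]
    refine ⟨j, Finset.mem_univ _, ?_⟩
    rw [WithTop.sum_eq_top]
    refine ⟨g, hg, ?_⟩
    rw [htop]
    apply WithTop.mul_top
    have : ω.w g ≠ 0 := Finsupp.mem_support_iff.mp hg
    exact_mod_cast this
  let c : Fin m → (D → C) → ℚ := fun j g =>
    (Γ.interp (F j) (fun l => g (h (X j l)))).untopD 0
  have hc : ∀ j, ∀ g ∈ ω.w.support,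
      Γ.interp (F j) (fun l => g (h (X j l))) = ((c j g : ℚ) : Cost) := by
    intro j g hg
    obtain ⟨q, hq⟩ := WithTop.ne_top_iff_exists.mp (hfin j g hg)
    simp only [c, ← hq, WithTop.untopD_coe]
  have h2 : ∑ j, ∑ g ∈ ω.w.support, ω.w g * c j g ≤ u := by
    have : ∑ j, ∑ g ∈ ω.w.support, ((ω.w g : ℚ) : Cost) *
        Γ.interp (F j) (fun l => g (h (X j l))) =
        ((∑ j, ∑ g ∈ ω.w.support, ω.w g * c j g : ℚ) : Cost) := by
      rw [WithTop.coe_sum]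
      refine Finset.sum_congr rfl fun j _ => ?_
      rw [WithTop.coe_sum]
      refine Finset.sum_congr rfl fun g hg => ?_
      rw [hc j g hg, WithTop.coe_mul]
    rw [this] at h1
    exact WithTop.coe_le_coe.mp h1
  have h3 : ∃ g ∈ ω.w.support, ω.w g * ∑ j, c j g ≤ ω.w g * u := by
    apply Finset.exists_le_of_sum_le
    · by_contra hne
      have := ω.sum_one
      rw [Finset.not_nonempty_iff_eq_empty.mp hne] at this
      simp at this
    · rw [← Finset.sum_mul, ω.sum_one, one_mul]
      simp only [Finset.mul_sum]
      rw [Finset.sum_comm]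
      exact h2
  obtain ⟨g, hg, hle⟩ := h3
  have hpos : 0 < ω.w g := lt_of_le_of_ne (ω.nonneg g) (Finsupp.mem_support_iff.mp hg).symm
  refine ⟨fun v => g (h v), ?_⟩
  have : objCost Γ F X (fun v => g (h v)) = ((∑ j, c j g : ℚ) : Cost) := by
    rw [WithTop.coe_sum]
    exact Finset.sum_congr rfl fun j _ => hc j g hg
  rw [this]
  exact WithTop.coe_le_coe.mpr (le_of_mul_le_mul_left hle hpos)
end

section
/- Let Γ be a valued τ-structure with domain C (τ finite), let Δ be a valued τ-structure with finite domain D, and let m ≥ 2. If there is a fractional homomorphism from Δ to Γ and Γ has an m-ary fully symmetric fractional polymorphism, then there is a fractional homomorphism from the multiset structure P^m(Δ) to Γ. -/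
open scoped Classical

/-- The multiset of size `m` determined by a tuple `v : Fin m → D`. -/
def tupleSym {D : Type*} {m : ℕ} (v : Fin m → D) : Sym D m :=
  ⟨(List.ofFn v : List D), by simp⟩

/-- The multiset structure `P^m(Δ)`: its domain is the set of multisets of
size `m` over `D`, and `f^{P^m(Δ)}(α₁,…,α_k)` is `1/m` times the minimum of
`Σ_{i<m} f^Δ(t¹_i,…,t^k_i)` over all tuples `t¹,…,t^k ∈ D^m` whose multisets
of entries are `α₁,…,α_k` respectively. -/
noncomputable def PmStruct {τ : Type*} {ar : τ → ℕ} {D : Type*} [Fintype D]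
    (m : ℕ) (Δ : VStruct τ ar D) : VStruct τ ar (Sym D m) where
  interp f α :=
    ((1 / m : ℚ) : Cost) *
      (Finset.univ.filter
          (fun t : Fin (ar f) → Fin m → D => ∀ l, tupleSym (t l) = α l)).inf
        (fun t => ∑ i, Δ.interp f (fun l => t l i))

/-- An `m`-ary fractional polymorphism of `Γ`: a finitely supported
probability distribution on operations `C^m → C` such that
`Σ_g ω(g)·f^Γ(g(a¹,…,a^m)) ≤ (1/m)·Σ_i f^Γ(aⁱ)` for every symbol `f` and all
tuples `a¹,…,a^m`, `g` being applied coordinatewise. -/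
structure FracPoly {τ : Type*} {ar : τ → ℕ} {C : Type*}
    (Γ : VStruct τ ar C) (m : ℕ) where
  w : ((Fin m → C) → C) →₀ ℚ
  nonneg : ∀ g, 0 ≤ w g
  sum_one : ∑ g ∈ w.support, w g = 1
  le : ∀ (f : τ) (a : Fin m → (Fin (ar f) → C)),
    ∑ g ∈ w.support, ((w g : ℚ) : Cost) * Γ.interp f (fun l => g (fun i => a i l))
      ≤ ((1 / m : ℚ) : Cost) * ∑ i, Γ.interp f (a i)

/-- A fractional operation is fully symmetric if every operation in its
support is invariant under permutations of its arguments. -/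
def FracPoly.FullySymmetric {τ : Type*} {ar : τ → ℕ} {C : Type*}
    {Γ : VStruct τ ar C} {m : ℕ} (ω : FracPoly Γ m) : Prop :=
  ∀ g ∈ ω.w.support, ∀ (π : Equiv.Perm (Fin m)) (x : Fin m → C), g (x ∘ π) = g x

theorem cost_mul_add (q : ℚ) (x y : Cost) : (q : Cost) * (x + y) = q * x + q * y := by
  by_cases hq : q = 0
  · subst hq; simp
  have hq' : (q : Cost) ≠ 0 := by exact_mod_cast hq
  induction x using WithTop.recTopCoe with
  | top => simp [WithTop.mul_top hq']
  | coe x =>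
    induction y using WithTop.recTopCoe with
    | top => simp [WithTop.mul_top hq']
    | coe y => norm_cast; ring

theorem cost_mul_sum {ι : Type*} (s : Finset ι) (q : ℚ) (x : ι → Cost) :
    (q : Cost) * ∑ i ∈ s, x i = ∑ i ∈ s, (q : Cost) * x i := by
  induction s using Finset.induction_on with
  | empty => simp
  | insert a s ha ih => rw [Finset.sum_insert ha, Finset.sum_insert ha, cost_mul_add, ih]

theorem cost_add_mul (p q : ℚ) (hp : 0 ≤ p) (hq : 0 ≤ q) (x : Cost) :
    ((p + q : ℚ) : Cost) * x = p * x + q * x := by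
  rcases hp.eq_or_lt with rfl | hp
  · simp
  induction x using WithTop.recTopCoe with
  | top =>
    have h1 : (p : Cost) ≠ 0 := by exact_mod_cast hp.ne'
    have h2 : ((p + q : ℚ) : Cost) ≠ 0 := by
      have : p + q ≠ 0 := by positivity
      exact_mod_cast this
    rw [WithTop.mul_top h1, WithTop.mul_top h2, top_add]
  | coe x => norm_cast; ring

theorem cost_sum_mul {ι : Type*} (s : Finset ι) (c : ι → ℚ) (hc : ∀ i ∈ s, 0 ≤ c i) (x : Cost) :
    ((∑ i ∈ s, c i : ℚ) : Cost) * x = ∑ i ∈ s, (c i : Cost) * x := by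
  induction s using Finset.induction_on with
  | empty => simp
  | insert a s ha ih =>
    rw [Finset.sum_insert ha, Finset.sum_insert ha, cost_add_mul, ih]
    · exact fun i hi => hc i (Finset.mem_insert_of_mem hi)
    · exact hc a (Finset.mem_insert_self _ _)
    · exact Finset.sum_nonneg fun i hi => hc i (Finset.mem_insert_of_mem hi)

theorem cost_mul_le (q : ℚ) (hq : 0 ≤ q) {x y : Cost} (h : x ≤ y) :
    (q : Cost) * x ≤ q * y := by
  rcases hq.eq_or_lt with rfl | hq
  · simp
  have h1 : (q : Cost) ≠ 0 := by exact_mod_cast hq.ne'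
  induction y using WithTop.recTopCoe with
  | top => simp [WithTop.mul_top h1]
  | coe y =>
    induction x using WithTop.recTopCoe with
    | top => simp at h
    | coe x =>
      have h : x ≤ y := by exact_mod_cast h
      exact_mod_cast mul_le_mul_of_nonneg_left h hq.le

/-- push-forward of a finite weighted family -/
noncomputable def pushW {ι X : Type*} (S : Finset ι) (G : ι → X) (c : ι → ℚ) : X →₀ ℚ :=
  ∑ p ∈ S, Finsupp.single (G p) (c p)

theorem pushW_apply {ι X : Type*} (S : Finset ι) (G : ι → X) (c : ι → ℚ) (x : X) :
    pushW S G c x = ∑ p ∈ S with G p = x, c p := by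
  simp [pushW, Finsupp.finsetSum_apply, Finsupp.single_apply, Finset.sum_filter]

theorem pushW_supp {ι X : Type*} (S : Finset ι) (G : ι → X) (c : ι → ℚ) :
    (pushW S G c).support ⊆ S.image G := by
  intro x hx
  by_contra hn
  rw [Finsupp.mem_support_iff, pushW_apply] at hx
  apply hx
  apply Finset.sum_eq_zero
  intro p hp
  rw [Finset.mem_filter] at hp
  exact absurd (Finset.mem_image.2 ⟨p, hp.1, hp.2⟩) hn

theorem pushW_sum {ι X : Type*} (S : Finset ι) (G : ι → X) (c : ι → ℚ) :
    ∑ x ∈ (pushW S G c).support, pushW S G c x = ∑ p ∈ S, c p := by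
  rw [Finset.sum_subset (pushW_supp S G c)
    (fun x _ hx => Finsupp.notMem_support_iff.1 hx)]
  simp_rw [pushW_apply]
  exact Finset.sum_fiberwise_of_maps_to (fun p hp => Finset.mem_image_of_mem G hp) c

theorem pushW_cost {ι X : Type*} (S : Finset ι) (G : ι → X) (c : ι → ℚ)
    (hc : ∀ i ∈ S, 0 ≤ c i) (F : X → Cost) :
    ∑ x ∈ (pushW S G c).support, ((pushW S G c x : ℚ) : Cost) * F x
      = ∑ p ∈ S, (c p : Cost) * F (G p) := by
  rw [Finset.sum_subset (pushW_supp S G c)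
    (fun x _ hx => by rw [Finsupp.notMem_support_iff.1 hx]; simp)]
  rw [← Finset.sum_fiberwise_of_maps_to (fun p hp => Finset.mem_image_of_mem G hp)]
  apply Finset.sum_congr rfl
  intro x _
  rw [pushW_apply, cost_sum_mul _ _ (fun i hi => hc i (Finset.mem_filter.1 hi).1)]
  apply Finset.sum_congr rfl
  intro p hp
  rw [(Finset.mem_filter.1 hp).2]

theorem tupleSym_surj {D : Type*} {m : ℕ} (α : Sym D m) : ∃ v : Fin m → D, tupleSym v = α := by
  obtain ⟨s, hs⟩ := α
  induction s using Quotient.inductionOn with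
  | h l =>
    have hl : l.length = m := hs
    subst hl
    refine ⟨l.get, Subtype.ext ?_⟩
    simp [tupleSym]

theorem tupleSym_eq {D : Type*} {m : ℕ} {u v : Fin m → D} (h : tupleSym u = tupleSym v) :
    ∃ π : Equiv.Perm (Fin m), u = v ∘ π := by
  have h' := congrArg Subtype.val h
  simp only [tupleSym] at h'
  have key : ∀ w : Fin m → D, ((List.ofFn w : List D) : Multiset D)
      = Multiset.map w Finset.univ.val := by
    intro w
    simp [List.ofFn_eq_map]
  rw [key, key] at h'
  have hcard : ∀ d, Nonempty ({i // u i = d} ≃ {i // v i = d}) := by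
    intro d
    rw [← Fintype.card_eq, Fintype.card_subtype, Fintype.card_subtype]
    have h2 := congrArg (Multiset.count d) h'
    rw [Multiset.count_map, Multiset.count_map] at h2
    simp only [eq_comm (a := d)] at h2
    exact h2
  refine ⟨Equiv.ofFiberEquiv fun d => (hcard d).some, ?_⟩
  funext i
  exact (Equiv.ofFiberEquiv_map _ i).symm

/-- If `τ` is finite, `Δ` has finite domain, there is a fractional
homomorphism from `Δ` to `Γ`, and `Γ` has an `m`-ary fully symmetric
fractional polymorphism (`m ≥ 2`), then there is a fractional homomorphism
from the multiset structure `P^m(Δ)` to `Γ`. -/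
theorem fracHom_of_PmStruct {τ : Type*} [Finite τ] {ar : τ → ℕ}
    {D C : Type*} [Fintype D]
    (Δ : VStruct τ ar D) (Γ : VStruct τ ar C) (m : ℕ) (hm : 2 ≤ m)
    (hom : FracHom Δ Γ) (ω : FracPoly Γ m) (hsym : ω.FullySymmetric) :
    Nonempty (FracHom (PmStruct m Δ) Γ) := by
  choose rep hrep using (tupleSym_surj (D := D) (m := m))
  let S := ω.w.support ×ˢ hom.w.support
  let G : ((Fin m → C) → C) × (D → C) → (Sym D m → C) := fun p α => p.1 (p.2 ∘ rep α)
  let c : ((Fin m → C) → C) × (D → C) → ℚ := fun p => ω.w p.1 * hom.w p.2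
  have hc : ∀ p, 0 ≤ c p := fun p => mul_nonneg (ω.nonneg _) (hom.nonneg _)
  refine ⟨⟨pushW S G c, ?_, ?_, ?_⟩⟩
  · intro g
    rw [pushW_apply]
    exact Finset.sum_nonneg fun p _ => hc p
  · rw [pushW_sum, Finset.sum_product]
    simp only [c]
    simp_rw [← Finset.mul_sum, hom.sum_one, mul_one]
    exact ω.sum_one
  · intro f α
    rw [pushW_cost S G c (fun p _ => hc p) (fun g => Γ.interp f (fun l => g (α l)))]
    have hne : (Finset.univ.filter
        (fun t : Fin (ar f) → Fin m → D => ∀ l, tupleSym (t l) = α l)).Nonempty :=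
      ⟨fun l => rep (α l), by simp [hrep]⟩
    obtain ⟨t, ht, hinf⟩ := Finset.exists_mem_eq_inf _ hne
      (fun t => ∑ i, Δ.interp f (fun l => t l i))
    simp only [PmStruct]
    rw [hinf]
    rw [Finset.mem_filter] at ht
    have ht := ht.2
    have hmq : (0 : ℚ) ≤ 1 / m := by positivity
    calc ∑ p ∈ S, (c p : Cost) * Γ.interp f (fun l => G p (α l))
        = ∑ h ∈ hom.w.support, ∑ g ∈ ω.w.support, (hom.w h : Cost) *
            ((ω.w g : Cost) * Γ.interp f (fun l => g (fun i => h (t l i)))) := by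
          rw [Finset.sum_product_right]
          refine Finset.sum_congr rfl fun h _ => Finset.sum_congr rfl fun g hg => ?_
          have e : (fun l => G (g, h) (α l)) = fun l => g (fun i => h (t l i)) := by
            funext l
            obtain ⟨π, hπ⟩ := tupleSym_eq ((hrep (α l)).trans (ht l).symm)
            simp only [G]
            rw [hπ, ← Function.comp_assoc, hsym g hg]
            rfl
          rw [e, ← mul_assoc, ← WithTop.coe_mul, mul_comm (hom.w h)]
      _ = ∑ h ∈ hom.w.support, (hom.w h : Cost) * ∑ g ∈ ω.w.support,
            ((ω.w g : Cost) * Γ.interp f (fun l => g (fun i => h (t l i)))) := by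
          simp_rw [cost_mul_sum]
      _ ≤ ∑ h ∈ hom.w.support, (hom.w h : Cost) *
            (((1 / m : ℚ) : Cost) * ∑ i, Γ.interp f (fun l => h (t l i))) :=
          Finset.sum_le_sum fun h _ => cost_mul_le _ (hom.nonneg h)
            (ω.le f (fun i l => h (t l i)))
      _ = ((1 / m : ℚ) : Cost) * ∑ i, ∑ h ∈ hom.w.support,
            (hom.w h : Cost) * Γ.interp f (fun l => h (t l i)) := by
          rw [Finset.sum_comm, cost_mul_sum]
          refine Finset.sum_congr rfl fun h _ => ?_
          rw [← cost_mul_sum, mul_left_comm]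
      _ ≤ ((1 / m : ℚ) : Cost) * ∑ i, Δ.interp f (fun l => t l i) :=
          cost_mul_le _ hmq (Finset.sum_le_sum fun i _ => hom.le f (fun l => t l i))
end

section
/- Let D be a linearly ordered set, let n ≥ 1, and let f : D^n → ℚ ∪ {+∞} be submodular. Then for every k ≥ 2 and all x¹,…,x^k ∈ D^n: Σ_{i=1}^{k} f(s_i^{(k)}(x¹,…,x^k)) ≤ Σ_{i=1}^{k} f(xⁱ), where s_i^{(k)}(x¹,…,x^k) ∈ D^n is the vector whose l-th component is the i-th smallest element, counted with multiplicity, of the multiset {x¹_l, …, x^k_l}. -/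
/-- The `i`-th smallest element (counted with multiplicity) of the multiset of
values of a tuple `v : Fin k → D`, for a linearly ordered set `D`. -/
def ithSmallest {D : Type*} [LinearOrder D] {k : ℕ} (v : Fin k → D)
    (i : Fin k) : D :=
  (Multiset.sort (↑(List.ofFn v) : Multiset D) (· ≤ ·)).get
    (Fin.cast (by simp) i)


theorem ithSmallest_eq_of_monotone {D : Type*} [LinearOrder D] {k : ℕ} (v : Fin k → D)
    (σ : Equiv.Perm (Fin k)) (h : Monotone (v ∘ σ)) (i : Fin k) :
    ithSmallest v i = v (σ i) := by
  have key : Multiset.sort (↑(List.ofFn v) : Multiset D) (· ≤ ·) = List.ofFn (v ∘ σ) := by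
    apply List.Perm.eq_of_pairwise' (r := (· ≤ ·))
    · exact Multiset.pairwise_sort _ _
    · exact h.sortedLE_ofFn.pairwise
    · rw [← Multiset.coe_eq_coe, Multiset.sort_eq, Multiset.coe_eq_coe]
      exact (σ.ofFn_comp_perm v).symm
  unfold ithSmallest
  rw [List.get_eq_getElem, List.getElem_of_eq key]
  simp only [List.getElem_ofFn]
  rfl

theorem sum_pair_split {k : ℕ} {M : Type*} [AddCommMonoid M] (g : Fin k → M) {i j : Fin k}
    (hij : i ≠ j) : ∑ a, g a = (g i + g j) + ∑ a ∈ (Finset.univ \ {i, j}), g a := by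
  rw [← Finset.sum_pair hij, add_comm, Finset.sum_sdiff (Finset.subset_univ _)]

theorem exists_sorting_perms {D : Type*} [LinearOrder D]
    (n : ℕ) (f : (Fin n → D) → Cost)
    (hsub : ∀ x y : Fin n → D,
      f (fun l => min (x l) (y l)) + f (fun l => max (x l) (y l)) ≤ f x + f y)
    (k : ℕ) (x : Fin k → Fin n → D) :
    ∃ σ : Fin n → Equiv.Perm (Fin k), ∑ i, f (fun l => x (σ l i) l) ≤ ∑ i, f (x i) ∧
      ∀ l, Monotone ((fun j => x j l) ∘ σ l) := by
  classical
  let r : Fin n → Fin k → ℕ := fun l j => (Finset.univ.filter (fun j' => x j' l < x j l)).card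
  have hr : ∀ l a b, x a l < x b l → r l a < r l b := by
    intro l a b hab
    apply Finset.card_lt_card
    rw [Finset.ssubset_iff_of_subset]
    · exact ⟨a, by simp [hab], by simp⟩
    · intro c hc
      simp only [Finset.mem_filter, Finset.mem_univ, true_and] at hc ⊢
      exact hc.trans hab
  let S : Finset (Fin n → Equiv.Perm (Fin k)) :=
    Finset.univ.filter (fun σ => ∑ i, f (fun l => x (σ l i) l) ≤ ∑ i, f (x i))
  have hS : S.Nonempty := ⟨fun _ => 1, by simp [S]⟩
  obtain ⟨σ, hσS, hmax⟩ := S.exists_max_image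
    (fun σ => ∑ l, ∑ i : Fin k, (i : ℕ) * r l (σ l i)) hS
  have hσ : ∑ i, f (fun l => x (σ l i) l) ≤ ∑ i, f (x i) := by simpa [S] using hσS
  refine ⟨σ, hσ, ?_⟩
  by_contra hcon
  push Not at hcon
  obtain ⟨l₀, hl₀⟩ := hcon
  rw [monotone_iff_forall_lt] at hl₀
  push Not at hl₀
  obtain ⟨i, j, hij, hlt⟩ := hl₀
  simp only [Function.comp] at hlt
  let τ : Fin n → Equiv.Perm (Fin k) := fun l =>
    if x (σ l j) l < x (σ l i) l then σ l * Equiv.swap i j else σ l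
  have τi : ∀ l, τ l i = if x (σ l j) l < x (σ l i) l then σ l j else σ l i := by
    intro l; simp only [τ]; split_ifs <;> simp
  have τj : ∀ l, τ l j = if x (σ l j) l < x (σ l i) l then σ l i else σ l j := by
    intro l; simp only [τ]; split_ifs <;> simp
  have τo : ∀ l a, a ≠ i → a ≠ j → τ l a = σ l a := by
    intro l a h1 h2; simp only [τ]
    split_ifs <;> simp [Equiv.swap_apply_of_ne_of_ne h1 h2]
  have hτ : ∑ a, f (fun l => x (τ l a) l) ≤ ∑ a, f (x a) := by
    refine le_trans ?_ hσ
    rw [sum_pair_split _ hij.ne, sum_pair_split (fun a => f (fun l => x (σ l a) l)) hij.ne]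
    refine add_le_add ?_ (le_of_eq ?_)
    · convert hsub (fun l => x (σ l i) l) (fun l => x (σ l j) l) using 3
      · funext l
        rw [τi]; split_ifs with h
        · exact (min_eq_right h.le).symm
        · exact (min_eq_left (not_lt.1 h)).symm
      · funext l
        rw [τj]; split_ifs with h
        · exact (max_eq_left h.le).symm
        · exact (max_eq_right (not_lt.1 h)).symm
    · refine Finset.sum_congr rfl fun a ha => ?_
      simp only [Finset.mem_sdiff, Finset.mem_univ, true_and, Finset.mem_insert,
        Finset.mem_singleton, not_or] at ha
      simp only [τo _ a ha.1 ha.2]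
  have hm := hmax τ (by simpa [S] using hτ)
  have hstep : ∀ l, x (σ l j) l < x (σ l i) l →
      ∑ a : Fin k, (a : ℕ) * r l (σ l a) < ∑ a : Fin k, (a : ℕ) * r l (τ l a) := by
    intro l h
    rw [sum_pair_split _ hij.ne, sum_pair_split (fun a : Fin k => (a : ℕ) * r l (τ l a)) hij.ne]
    refine add_lt_add_of_lt_of_le ?_ (le_of_eq ?_)
    · rw [τi, τj, if_pos h, if_pos h]
      have h1 := hr l _ _ h
      have h2 : (i : ℕ) < j := hij
      nlinarith
    · refine Finset.sum_congr rfl fun a ha => ?_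
      simp only [Finset.mem_sdiff, Finset.mem_univ, true_and, Finset.mem_insert,
        Finset.mem_singleton, not_or] at ha
      simp only [τo _ a ha.1 ha.2]
  refine absurd hm (not_le.2 ?_)
  refine Finset.sum_lt_sum (fun l _ => ?_) ⟨l₀, Finset.mem_univ _, hstep l₀ hlt⟩
  by_cases h : x (σ l j) l < x (σ l i) l
  · exact (hstep l h).le
  · simp [τ, h]

/-- Submodular cost functions are improved by the family of "sorting"
operations: if `f : D^n → ℚ ∪ {+∞}` is submodular, then for every `k ≥ 2` and
all `x¹,…,x^k ∈ D^n` we have `Σ_i f(s_i^{(k)}(x¹,…,x^k)) ≤ Σ_i f(xⁱ)`, where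
the `l`-th component of `s_i^{(k)}(x¹,…,x^k)` is the `i`-th smallest element
of the multiset `{x¹_l,…,x^k_l}`. -/
theorem submodular_improved_by_sorting {D : Type*} [LinearOrder D]
    (n : ℕ) (hn : 1 ≤ n) (f : (Fin n → D) → Cost)
    (hsub : ∀ x y : Fin n → D,
      f (fun l => min (x l) (y l)) + f (fun l => max (x l) (y l)) ≤ f x + f y)
    (k : ℕ) (hk : 2 ≤ k) (x : Fin k → Fin n → D) :
    ∑ i, f (fun l => ithSmallest (fun j => x j l) i) ≤ ∑ i, f (x i) := by
  obtain ⟨σ, h1, h2⟩ := exists_sorting_perms n f hsub k x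
  refine le_trans (le_of_eq ?_) h1
  refine Finset.sum_congr rfl fun i _ => ?_
  congr 1
  funext l
  exact ithSmallest_eq_of_monotone (fun j => x j l) (σ l) (h2 l) i
end
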